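/- arXiv:1601.06606 — 4 statements merged into one kernel-verified Lean document; each statement's English description precedes it below -/
import Mathlib

section
/- Let μ be any probability measure on [0,1], let θ have law μ, and for each n ≥ 1 let X̄_n have law P[X̄_n = k/n] = C(n,k) ∫_0^1 t^k (1-t)^{n-k} μ(dt), k = 0,…,n. Then E[θ(1−θ)]/n ≤ d_W(X̄_n, θ) ≤ √(E[θ(1−θ)]/n). -/
open MeasureTheory ProbabilityTheory Set

/-- Wasserstein distance between two laws on ℝ (dual formulation):
`d_W(μ,ν) = sup over 1-Lipschitz φ of |∫φ dμ - ∫φ dν|`. -/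
noncomputable def dW (μ ν : Measure ℝ) : ℝ :=
  ⨆ φ : {f : ℝ → ℝ // LipschitzWith 1 f}, |(∫ x, φ.1 x ∂μ) - ∫ x, φ.1 x ∂ν|

/-- Law of the empirical mean `X̄ₙ` of the first `n` terms of an exchangeable 0-1 sequence
with de Finetti mixing measure `μ` : `P[X̄ₙ = k/n] = C(n,k) ∫ t^k (1-t)^(n-k) dμ(t)`. -/
noncomputable def barLaw (μ : Measure ℝ) (n : ℕ) : Measure ℝ :=
  ∑ k ∈ Finset.range (n + 1),
    (ENNReal.ofReal ((n.choose k : ℝ) * ∫ t, t ^ k * (1 - t) ^ (n - k) ∂μ)) •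
      Measure.dirac ((k : ℝ) / n)

/-- The Bernstein weight `C(n,k) t^k (1-t)^(n-k)`, the binomial probability of `k`. -/
noncomputable def bernsteinWeight (n k : ℕ) (t : ℝ) : ℝ :=
  (n.choose k : ℝ) * (t ^ k * (1 - t) ^ (n - k))

theorem continuous_bernsteinWeight (n k : ℕ) : Continuous (bernsteinWeight n k) := by
  unfold bernsteinWeight
  fun_prop

theorem bernsteinWeight_nonneg (n k : ℕ) {t : ℝ} (ht : t ∈ Icc (0 : ℝ) 1) :
    0 ≤ bernsteinWeight n k t := by
  have h0 := ht.1
  have h1 : 0 ≤ 1 - t := sub_nonneg.2 ht.2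
  unfold bernsteinWeight
  positivity

theorem bernsteinPolynomial_eval_eq_weight (n k : ℕ) (t : ℝ) :
    (bernsteinPolynomial ℝ n k).eval t = bernsteinWeight n k t := by
  simp [bernsteinPolynomial, bernsteinWeight, mul_assoc]

theorem sum_bernsteinWeight (n : ℕ) (t : ℝ) :
    ∑ k ∈ Finset.range (n + 1), bernsteinWeight n k t = 1 := by
  simpa [Polynomial.eval_finsetSum, bernsteinPolynomial_eval_eq_weight] using
    congrArg (Polynomial.eval t) (bernsteinPolynomial.sum ℝ n)

theorem sum_bernsteinWeight_mul (n : ℕ) (hn : 1 ≤ n) (t : ℝ) :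
    ∑ k ∈ Finset.range (n + 1), bernsteinWeight n k t * ((k : ℝ) / n) = t := by
  have h := congrArg (Polynomial.eval t) (bernsteinPolynomial.sum_smul ℝ n)
  simp only [Polynomial.eval_finsetSum, nsmul_eq_mul, Polynomial.eval_mul,
    Polynomial.eval_natCast, bernsteinPolynomial_eval_eq_weight, Polynomial.eval_X] at h
  have hn0 : (n : ℝ) ≠ 0 := by positivity
  calc
    _ = (∑ k ∈ Finset.range (n + 1), (k : ℝ) * bernsteinWeight n k t) / n := by
      rw [Finset.sum_div]
      exact Finset.sum_congr rfl fun k _ => by ring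
    _ = t := by rw [h]; field_simp

theorem sum_bernsteinWeight_mul_sq (n : ℕ) (hn : 1 ≤ n) (t : ℝ) :
    ∑ k ∈ Finset.range (n + 1), bernsteinWeight n k t * ((k : ℝ) / n - t) ^ 2 =
      t * (1 - t) / n := by
  have h := congrArg (Polynomial.eval t) (bernsteinPolynomial.variance ℝ n)
  simp only [Polynomial.eval_finsetSum, nsmul_eq_mul, Polynomial.eval_mul, Polynomial.eval_pow,
    Polynomial.eval_sub, Polynomial.eval_one,
    Polynomial.eval_natCast, bernsteinPolynomial_eval_eq_weight, Polynomial.eval_X] at h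
  have hn0 : (n : ℝ) ≠ 0 := by positivity
  calc
    _ = (∑ k ∈ Finset.range (n + 1), (n * t - (k : ℝ)) ^ 2 * bernsteinWeight n k t) / n ^ 2 := by
      rw [Finset.sum_div]
      refine Finset.sum_congr rfl fun k _ => ?_
      field_simp
      ring
    _ = t * (1 - t) / n := by rw [h]; field_simp

theorem Continuous.integrable_of_measure_compl_Icc {μ : Measure ℝ} [IsFiniteMeasure μ] {a b : ℝ}
    (hμ : μ (Icc a b)ᶜ = 0) {f : ℝ → ℝ} (hf : Continuous f) : Integrable f μ := by
  have h : IntegrableOn f (Icc a b) μ := hf.continuousOn.integrableOn_compact isCompact_Icc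
  have hmem : ∀ᵐ t ∂μ, t ∈ Icc a b := mem_ae_iff.2 hμ
  rwa [IntegrableOn, Measure.restrict_eq_self_of_ae_mem hmem] at h

theorem integral_barLaw {μ : Measure ℝ} [IsFiniteMeasure μ]
    (hμ : μ (Icc (0 : ℝ) 1)ᶜ = 0) (n : ℕ) (f : ℝ → ℝ) :
    ∫ x, f x ∂(barLaw μ n) =
      ∫ t, ∑ k ∈ Finset.range (n + 1), bernsteinWeight n k t * f ((k : ℝ) / n) ∂μ := by
  rw [barLaw, integral_finsetSum_measure fun k _ =>
    (integrable_dirac (by simp)).smul_measure ENNReal.ofReal_ne_top,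
    integral_finsetSum _ fun k _ =>
      ((continuous_bernsteinWeight n k).integrable_of_measure_compl_Icc hμ).mul_const _]
  refine Finset.sum_congr rfl fun k _ => ?_
  have hmem : ∀ᵐ t ∂μ, t ∈ Icc (0 : ℝ) 1 := mem_ae_iff.2 hμ
  rw [integral_smul_measure, integral_dirac, ← integral_const_mul, integral_mul_const,
    smul_eq_mul]
  congr 1
  exact ENNReal.toReal_ofReal (integral_nonneg_of_ae
    (hmem.mono fun t ht => bernsteinWeight_nonneg n k ht))

/-- The joint expectation `E|X̄ₙ - θ|` is at most `√(E[θ(1-θ)]/n)`. -/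
theorem integral_sum_bernsteinWeight_mul_abs_le {μ : Measure ℝ} [IsProbabilityMeasure μ]
    (hμ : μ (Icc (0 : ℝ) 1)ᶜ = 0) (n : ℕ) (hn : 1 ≤ n) :
    ∫ t, ∑ k ∈ Finset.range (n + 1), bernsteinWeight n k t * |(k : ℝ) / n - t| ∂μ ≤
      Real.sqrt ((∫ t, t * (1 - t) ∂μ) / n) := by
  have hcont := continuous_bernsteinWeight n
  set g : ℝ → ℝ := fun t =>
    ∑ k ∈ Finset.range (n + 1), bernsteinWeight n k t * |(k : ℝ) / n - t|
  have hgc : Continuous g := by fun_prop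
  set A := ∫ t, g t ∂μ
  have hmem : ∀ᵐ t ∂μ, t ∈ Icc (0 : ℝ) 1 := mem_ae_iff.2 hμ
  have key : ∀ᵐ t ∂μ, 2 * A * g t - A ^ 2 ≤ t * (1 - t) / n := by
    filter_upwards [hmem] with t ht
    have h : 0 ≤ ∑ k ∈ Finset.range (n + 1),
        bernsteinWeight n k t * (|(k : ℝ) / n - t| - A) ^ 2 :=
      Finset.sum_nonneg fun k _ => mul_nonneg (bernsteinWeight_nonneg n k ht) (sq_nonneg _)
    have h' : ∑ k ∈ Finset.range (n + 1),
        bernsteinWeight n k t * (|(k : ℝ) / n - t| - A) ^ 2 =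
        t * (1 - t) / n - 2 * A * g t + A ^ 2 := by
      calc
        _ = ∑ k ∈ Finset.range (n + 1), (bernsteinWeight n k t * ((k : ℝ) / n - t) ^ 2 -
            2 * A * (bernsteinWeight n k t * |(k : ℝ) / n - t|) +
              bernsteinWeight n k t * A ^ 2) := by
          refine Finset.sum_congr rfl fun k _ => ?_
          rw [← sq_abs ((k : ℝ) / n - t)]
          ring
        _ = _ := by
          rw [Finset.sum_add_distrib, Finset.sum_sub_distrib, ← Finset.mul_sum,
            ← Finset.sum_mul, sum_bernsteinWeight, sum_bernsteinWeight_mul_sq n hn, one_mul]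
    linarith
  have hint : Integrable (fun t => 2 * A * g t) μ :=
    Continuous.integrable_of_measure_compl_Icc hμ (by fun_prop)
  have hle := integral_mono_ae (hint.sub (integrable_const (A ^ 2)))
    (Continuous.integrable_of_measure_compl_Icc hμ (by fun_prop)) key
  simp only [Pi.sub_apply] at hle
  rw [integral_sub hint (integrable_const _), integral_const_mul, integral_div] at hle
  simp only [integral_const, probReal_univ, one_smul] at hle
  exact Real.le_sqrt_of_sq_le (by nlinarith)

theorem abs_integral_barLaw_sub_le {μ : Measure ℝ} [IsProbabilityMeasure μ]
    (hμ : μ (Icc (0 : ℝ) 1)ᶜ = 0) (n : ℕ) (hn : 1 ≤ n) {f : ℝ → ℝ} (hf : LipschitzWith 1 f) :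
    |(∫ x, f x ∂(barLaw μ n)) - ∫ x, f x ∂μ| ≤ Real.sqrt ((∫ t, t * (1 - t) ∂μ) / n) := by
  have hcont := continuous_bernsteinWeight n
  have hfc := hf.continuous
  have hmem : ∀ᵐ t ∂μ, t ∈ Icc (0 : ℝ) 1 := mem_ae_iff.2 hμ
  rw [integral_barLaw hμ, ← integral_sub
    (Continuous.integrable_of_measure_compl_Icc hμ (by fun_prop))
    (hfc.integrable_of_measure_compl_Icc hμ)]
  refine abs_integral_le_integral_abs.trans (le_trans (integral_mono_ae
    (Continuous.integrable_of_measure_compl_Icc hμ (by fun_prop))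
    (Continuous.integrable_of_measure_compl_Icc hμ (by fun_prop)) ?_)
    (integral_sum_bernsteinWeight_mul_abs_le hμ n hn))
  filter_upwards [hmem] with t ht
  have h : (∑ k ∈ Finset.range (n + 1), bernsteinWeight n k t * f ((k : ℝ) / n)) - f t =
      ∑ k ∈ Finset.range (n + 1), bernsteinWeight n k t * (f ((k : ℝ) / n) - f t) := by
    simp_rw [mul_sub]
    rw [Finset.sum_sub_distrib, ← Finset.sum_mul, sum_bernsteinWeight, one_mul]
  rw [h]
  refine (Finset.abs_sum_le_sum_abs _ _).trans (Finset.sum_le_sum fun k _ => ?_)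
  rw [abs_mul, abs_of_nonneg (bernsteinWeight_nonneg n k ht)]
  refine mul_le_mul_of_nonneg_left ?_ (bernsteinWeight_nonneg n k ht)
  simpa [Real.dist_eq] using hf.dist_le_mul ((k : ℝ) / n) t

theorem lipschitzOnWith_sq_sub_self :
    LipschitzOnWith 1 (fun x : ℝ => x ^ 2 - x) (Icc (0 : ℝ) 1) := by
  refine LipschitzOnWith.of_dist_le_mul fun x hx y hy => ?_
  rw [Real.dist_eq, Real.dist_eq, NNReal.coe_one,
    show x ^ 2 - x - (y ^ 2 - y) = (x + y - 1) * (x - y) by ring, abs_mul]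
  refine mul_le_mul_of_nonneg_right (abs_le.2 ?_) (abs_nonneg _)
  constructor <;> linarith [hx.1, hx.2, hy.1, hy.2]

theorem exists_lipschitzWith_integral_barLaw_sub_eq {μ : Measure ℝ} [IsProbabilityMeasure μ]
    (hμ : μ (Icc (0 : ℝ) 1)ᶜ = 0) (n : ℕ) (hn : 1 ≤ n) :
    ∃ f : ℝ → ℝ, LipschitzWith 1 f ∧
      (∫ x, f x ∂(barLaw μ n)) - ∫ x, f x ∂μ = (∫ t, t * (1 - t) ∂μ) / n := by
  obtain ⟨f, hf, hfeq⟩ := lipschitzOnWith_sq_sub_self.extend_real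
  refine ⟨f, hf, ?_⟩
  have hcont := continuous_bernsteinWeight n
  have hfc := hf.continuous
  have hmem : ∀ᵐ t ∂μ, t ∈ Icc (0 : ℝ) 1 := mem_ae_iff.2 hμ
  rw [integral_barLaw hμ, ← integral_sub
    (Continuous.integrable_of_measure_compl_Icc hμ (by fun_prop))
    (hfc.integrable_of_measure_compl_Icc hμ), ← integral_div]
  refine integral_congr_ae ?_
  filter_upwards [hmem] with t ht
  have hgrid : ∀ k ∈ Finset.range (n + 1), f ((k : ℝ) / n) = ((k : ℝ) / n) ^ 2 - (k : ℝ) / n := by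
    refine fun k hk => (hfeq ⟨by positivity, div_le_one_of_le₀ ?_ (by positivity)⟩).symm
    exact_mod_cast Nat.lt_succ_iff.1 (Finset.mem_range.1 hk)
  calc
    _ = (∑ k ∈ Finset.range (n + 1), (bernsteinWeight n k t * ((k : ℝ) / n - t) ^ 2 +
          (2 * t - 1) * (bernsteinWeight n k t * ((k : ℝ) / n)) -
          bernsteinWeight n k t * t ^ 2)) - (t ^ 2 - t) := by
      rw [← hfeq ht]
      refine congrArg (· - _) (Finset.sum_congr rfl fun k hk => ?_)
      rw [hgrid k hk]
      ring
    _ = t * (1 - t) / n := by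
      rw [Finset.sum_sub_distrib, Finset.sum_add_distrib, ← Finset.mul_sum, ← Finset.sum_mul,
        sum_bernsteinWeight, sum_bernsteinWeight_mul_sq n hn, sum_bernsteinWeight_mul n hn]
      ring

/-- For any mixing measure `μ` on `[0,1]`:
`E[θ(1-θ)]/n ≤ d_W(X̄ₙ, θ) ≤ √(E[θ(1-θ)]/n)`. -/
theorem stmt_1 (μ : Measure ℝ) [IsProbabilityMeasure μ]
    (hsupp : μ (Set.Icc (0 : ℝ) 1)ᶜ = 0) (n : ℕ) (hn : 1 ≤ n) :
    (∫ t, t * (1 - t) ∂μ) / n ≤ dW (barLaw μ n) μ ∧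
    dW (barLaw μ n) μ ≤ Real.sqrt ((∫ t, t * (1 - t) ∂μ) / n) := by
  constructor
  · obtain ⟨f, hf, hfeq⟩ := exists_lipschitzWith_integral_barLaw_sub_eq hsupp n hn
    rw [← hfeq]
    refine (le_abs_self _).trans (le_ciSup (f := fun φ : {f : ℝ → ℝ // LipschitzWith 1 f} =>
      |(∫ x, φ.1 x ∂(barLaw μ n)) - ∫ x, φ.1 x ∂μ|)
      ⟨Real.sqrt ((∫ t, t * (1 - t) ∂μ) / n), ?_⟩ ⟨f, hf⟩)
    rintro _ ⟨φ, rfl⟩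
    exact abs_integral_barLaw_sub_le hsupp n hn φ.2
  · exact Real.iSup_le (fun φ => abs_integral_barLaw_sub_le hsupp n hn φ.2) (Real.sqrt_nonneg _)
end

section
/- Let μ be a probability measure on [0,1] with μ({0,1}) < 1, let θ have law μ, and let X̄_n have law P[X̄_n = k/n] = C(n,k) ∫_0^1 t^k (1-t)^{n-k} μ(dt). Define the probability measure μ̃ on [0,1] by μ̃(A) = μ(A \ {0,1}) / (1 − μ({0,1})), let θ̃ have law μ̃, and let Ȳ_n have law P[Ȳ_n = k/n] = C(n,k) ∫_0^1 t^k (1-t)^{n-k} μ̃(dt). Then μ̃({0,1}) = 0 and, for every n ≥ 1, d_W(X̄_n, θ) = (1 − μ({0,1})) · d_W(Ȳ_n, θ̃). -/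
open MeasureTheory ProbabilityTheory Set

/-- The Bernstein polynomial of degree `n` of a function `φ`, as a function on `ℝ`. -/
noncomputable def bernsteinSum (φ : ℝ → ℝ) (n : ℕ) (t : ℝ) : ℝ :=
  ∑ k ∈ Finset.range (n + 1), ((n.choose k : ℝ) * (t ^ k * (1 - t) ^ (n - k))) * φ ((k : ℝ) / n)

lemma continuous_bernsteinSum (φ : ℝ → ℝ) (n : ℕ) : Continuous (bernsteinSum φ n) := by
  unfold bernsteinSum
  fun_prop

lemma bernsteinSum_zero (φ : ℝ → ℝ) (n : ℕ) : bernsteinSum φ n 0 = φ 0 := by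
  unfold bernsteinSum
  rw [Finset.sum_eq_single 0]
  · simp
  · intro k _ hk
    simp [hk]
  · simp

lemma bernsteinSum_one (φ : ℝ → ℝ) {n : ℕ} (hn : 1 ≤ n) : bernsteinSum φ n 1 = φ 1 := by
  unfold bernsteinSum
  have hn' : (n : ℝ) ≠ 0 := by positivity
  rw [Finset.sum_eq_single n]
  · simp [hn']
  · intro k hk hkn
    have : n - k ≠ 0 := by
      have := Finset.mem_range.1 hk
      omega
    simp [this]
  · simp

lemma Continuous.integrable_of_measure_compl_Icc_eq_zero {ν : Measure ℝ} [IsFiniteMeasure ν]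
    {a b : ℝ} (hν : ν (Set.Icc a b)ᶜ = 0) {g : ℝ → ℝ} (hg : Continuous g) : Integrable g ν := by
  have h : ν.restrict (Set.Icc a b) = ν := Measure.restrict_eq_self_of_ae_mem hν
  rw [← h]
  exact hg.continuousOn.integrableOn_compact isCompact_Icc

lemma integral_barLaw_s2 {ν : Measure ℝ} [IsFiniteMeasure ν]
    (hν : ν (Set.Icc (0 : ℝ) 1)ᶜ = 0) (φ : ℝ → ℝ) (n : ℕ) :
    ∫ x, φ x ∂(barLaw ν n) = ∫ t, bernsteinSum φ n t ∂ν := by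
  unfold barLaw bernsteinSum
  rw [integral_finsetSum_measure, integral_finsetSum]
  · refine Finset.sum_congr rfl fun k _ => ?_
    rw [integral_smul_measure, integral_dirac, integral_mul_const, integral_const_mul,
      ENNReal.toReal_ofReal, smul_eq_mul]
    refine mul_nonneg (by positivity) (integral_nonneg_of_ae ?_)
    have hmem : ∀ᵐ t ∂ν, t ∈ Set.Icc (0 : ℝ) 1 := hν
    filter_upwards [hmem] with t ht
    exact mul_nonneg (pow_nonneg ht.1 _) (pow_nonneg (sub_nonneg.2 ht.2) _)
  · intro k _
    exact Continuous.integrable_of_measure_compl_Icc_eq_zero hν (by fun_prop)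
  · intro k _
    exact (integrable_dirac (by simp)).smul_measure ENNReal.ofReal_ne_top

lemma integral_barLaw_sub_integral {ν : Measure ℝ} [IsFiniteMeasure ν]
    (hν : ν (Set.Icc (0 : ℝ) 1)ᶜ = 0) {φ : ℝ → ℝ} (hφ : Continuous φ) (n : ℕ) :
    (∫ x, φ x ∂(barLaw ν n)) - ∫ x, φ x ∂ν = ∫ t, (bernsteinSum φ n t - φ t) ∂ν := by
  rw [integral_barLaw_s2 hν, integral_sub]
  · exact Continuous.integrable_of_measure_compl_Icc_eq_zero hν (continuous_bernsteinSum φ n)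
  · exact Continuous.integrable_of_measure_compl_Icc_eq_zero hν hφ

/-- Killing the mass of `μ` at `{0,1}`: if `μ̃(A) = μ(A \ {0,1})/(1-μ({0,1}))`, then
`μ̃({0,1}) = 0` and `d_W(X̄ₙ, θ) = (1-μ({0,1})) d_W(Ȳₙ, θ̃)`. -/
theorem stmt_2 (μ : Measure ℝ) [IsProbabilityMeasure μ]
    (hsupp : μ (Set.Icc (0 : ℝ) 1)ᶜ = 0) (hlt : μ ({0, 1} : Set ℝ) < 1)
    (μt : Measure ℝ)
    (hμt : μt = (1 - μ ({0, 1} : Set ℝ))⁻¹ • μ.restrict (({0, 1} : Set ℝ)ᶜ))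
    (n : ℕ) (hn : 1 ≤ n) :
    μt ({0, 1} : Set ℝ) = 0 ∧
    dW (barLaw μ n) μ = (1 - (μ ({0, 1} : Set ℝ)).toReal) * dW (barLaw μt n) μt := by
  have hS : MeasurableSet ({0, 1} : Set ℝ) := (Set.toFinite _).measurableSet
  have hc : (1 - μ ({0, 1} : Set ℝ)) ≠ 0 := (tsub_pos_of_lt hlt).ne'
  have hp : (1 - μ ({0, 1} : Set ℝ)).toReal = 1 - (μ ({0, 1} : Set ℝ)).toReal := by
    rw [ENNReal.toReal_sub_of_le hlt.le ENNReal.one_ne_top, ENNReal.toReal_one]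
  have hpos : 0 ≤ 1 - (μ ({0, 1} : Set ℝ)).toReal := hp ▸ ENNReal.toReal_nonneg
  have hp0 : 1 - (μ ({0, 1} : Set ℝ)).toReal ≠ 0 := by
    rw [← hp]
    exact ENNReal.toReal_ne_zero.2 ⟨hc, (tsub_le_self.trans_lt ENNReal.one_lt_top).ne⟩
  refine ⟨by simp [hμt, Measure.restrict_apply hS], ?_⟩
  have hfin : IsFiniteMeasure μt := by
    rw [hμt]
    exact Measure.smul_finite _ (ENNReal.inv_ne_top.2 hc)
  have hsupp' : μt (Set.Icc (0 : ℝ) 1)ᶜ = 0 := by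
    have : μ.restrict (({0, 1} : Set ℝ)ᶜ) (Set.Icc (0 : ℝ) 1)ᶜ = 0 :=
      nonpos_iff_eq_zero.1 ((Measure.restrict_apply_le _ _).trans hsupp.le)
    rw [hμt, Measure.smul_apply, this, smul_zero]
  unfold dW
  rw [Real.mul_iSup_of_nonneg hpos]
  refine iSup_congr fun φ => ?_
  rw [integral_barLaw_sub_integral hsupp φ.2.continuous,
    integral_barLaw_sub_integral hsupp' φ.2.continuous]
  have hvanish : ∀ t, t ∉ (({0, 1} : Set ℝ)ᶜ) → bernsteinSum φ.1 n t - φ.1 t = 0 := by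
    intro t ht
    rcases not_not.1 ht with rfl | rfl
    · rw [bernsteinSum_zero, sub_self]
    · rw [bernsteinSum_one _ hn, sub_self]
  rw [← setIntegral_eq_integral_of_forall_compl_eq_zero hvanish, hμt, integral_smul_measure,
    ENNReal.toReal_inv, hp, smul_eq_mul, abs_mul, abs_inv, abs_of_nonneg hpos,
    mul_inv_cancel_left₀ hp0]
end

section
/- Let μ be a probability measure on [0,1] with μ({0,1}) = 0, let θ have law μ, let X̄_n have law P[X̄_n = k/n] = C(n,k) ∫_0^1 t^k (1-t)^{n-k} μ(dt), and let Z be a standard normal random variable independent of θ. Then the sequences a_n = d_W(X̄_n, θ) and b_n = d_W(θ + √(θ(1−θ)/n) Z, θ) are of the same order: there exist constants 0 < c ≤ C (depending only on μ) such that c·b_n ≤ a_n ≤ C·b_n for all n ≥ 1. -/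
open MeasureTheory ProbabilityTheory Set

/-- Law of `θ + √(θ(1-θ)/n)·Z` where `θ ~ μ` and `Z` is an independent standard normal. -/
noncomputable def perturbedLaw (μ : Measure ℝ) (n : ℕ) : Measure ℝ :=
  Measure.map (fun q : ℝ × ℝ => q.1 + Real.sqrt (q.1 * (1 - q.1) / n) * q.2)
    (μ.prod (gaussianReal 0 1))

/-- Expectation of `φ` under the binomial law with parameters `n` and `p`. -/
noncomputable def binomialMean (p : ℝ) (n : ℕ) (φ : ℕ → ℝ) : ℝ :=
  ∑ k ∈ Finset.range (n + 1), (n.choose k : ℝ) * p ^ k * (1 - p) ^ (n - k) * φ k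

namespace binomialMean

lemma add (p : ℝ) (n : ℕ) (φ ψ : ℕ → ℝ) :
    binomialMean p n (fun k => φ k + ψ k) = binomialMean p n φ + binomialMean p n ψ := by
  simp only [binomialMean, mul_add, Finset.sum_add_distrib]

lemma sub (p : ℝ) (n : ℕ) (φ ψ : ℕ → ℝ) :
    binomialMean p n (fun k => φ k - ψ k) = binomialMean p n φ - binomialMean p n ψ := by
  simp only [binomialMean, mul_sub, Finset.sum_sub_distrib]

lemma const_mul (p : ℝ) (n : ℕ) (c : ℝ) (φ : ℕ → ℝ) :
    binomialMean p n (fun k => c * φ k) = c * binomialMean p n φ := by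
  simp only [binomialMean, Finset.mul_sum]
  exact Finset.sum_congr rfl fun k _ => by ring

lemma const (p : ℝ) (n : ℕ) (c : ℝ) : binomialMean p n (fun _ => c) = c := by
  have h := add_pow p (1 - p) n
  rw [add_sub_cancel, one_pow] at h
  rw [binomialMean, ← Finset.sum_mul]
  convert one_mul c
  refine Eq.trans (Finset.sum_congr rfl fun k _ => ?_) h.symm
  ring

lemma abs_le {p : ℝ} (hp : p ∈ Icc (0 : ℝ) 1) (n : ℕ) {φ : ℕ → ℝ} {M : ℝ}
    (h : ∀ k, |φ k| ≤ M) : |binomialMean p n φ| ≤ M := by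
  rw [← const p n M]
  refine (Finset.abs_sum_le_sum_abs _ _).trans (Finset.sum_le_sum fun k _ => ?_)
  have hw : 0 ≤ (n.choose k : ℝ) * p ^ k * (1 - p) ^ (n - k) := by
    have := hp.1
    have : 0 ≤ 1 - p := sub_nonneg.2 hp.2
    positivity
  rw [abs_mul, abs_of_nonneg hw]
  exact mul_le_mul_of_nonneg_left (h k) hw

lemma succ_cast_mul (p : ℝ) (n : ℕ) (φ : ℕ → ℝ) :
    binomialMean p (n + 1) (fun k => k * φ k) =
      (n + 1) * p * binomialMean p n (fun k => φ (k + 1)) := by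
  rw [binomialMean, Finset.sum_range_succ', binomialMean, Finset.mul_sum]
  simp only [Nat.cast_zero, zero_mul, mul_zero, add_zero]
  refine Finset.sum_congr rfl fun k _ => ?_
  have h : ((n : ℝ) + 1) * n.choose k = (n + 1).choose (k + 1) * (k + 1) := by
    exact_mod_cast Nat.add_one_mul_choose_eq n k
  rw [Nat.add_sub_add_right]
  push_cast
  linear_combination (-(p ^ (k + 1) * (1 - p) ^ (n - k) * φ (k + 1))) * h

lemma succ_sub_cast_mul (p : ℝ) (n : ℕ) (φ : ℕ → ℝ) :
    binomialMean p (n + 1) (fun k => ((n : ℝ) + 1 - k) * φ k) =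
      (n + 1) * (1 - p) * binomialMean p n φ := by
  rw [binomialMean, Finset.sum_range_succ, binomialMean, Finset.mul_sum]
  push_cast
  simp only [sub_self, zero_mul, mul_zero, add_zero]
  refine Finset.sum_congr rfl fun k hk => ?_
  have hk' : k ≤ n := Nat.lt_succ_iff.1 (Finset.mem_range.1 hk)
  have h : ((n : ℝ) + 1) * n.choose k = (n + 1).choose k * (n + 1 - k) := by
    have := Nat.choose_mul_succ_eq n k
    rw [← Nat.cast_inj (R := ℝ)] at this
    push_cast [Nat.cast_sub (show k ≤ n + 1 by omega)] at this
    linarith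
  rw [show n + 1 - k = n - k + 1 by omega, pow_succ]
  linear_combination (-(p ^ k * (1 - p) ^ (n - k) * (1 - p) * φ k)) * h

lemma succ (p : ℝ) (n : ℕ) (φ : ℕ → ℝ) :
    binomialMean p (n + 1) φ =
      binomialMean p n (fun k => p * φ (k + 1) + (1 - p) * φ k) := by
  have h := add p (n + 1) (fun k => k * φ k) (fun k => ((n : ℝ) + 1 - k) * φ k)
  rw [succ_cast_mul, succ_sub_cast_mul,
    show (fun k : ℕ => (k : ℝ) * φ k + ((n : ℝ) + 1 - k) * φ k) = fun k => ((n : ℝ) + 1) * φ k from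
      funext fun k => by ring, const_mul] at h
  rw [add, const_mul, const_mul]
  have hn : (n : ℝ) + 1 ≠ 0 := by positivity
  apply mul_left_cancel₀ hn
  linear_combination h

lemma succ_centered_mul (p : ℝ) (n : ℕ) (φ : ℕ → ℝ) :
    binomialMean p (n + 1) (fun k => (k - ((n : ℝ) + 1) * p) * φ k) =
      (n + 1) * p * (1 - p) * binomialMean p n (fun k => φ (k + 1) - φ k) := by
  have h := sub p (n + 1) (fun k => (1 - p) * (k * φ k)) (fun k => p * (((n : ℝ) + 1 - k) * φ k))
  rw [const_mul, const_mul, succ_cast_mul, succ_sub_cast_mul] at h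
  rw [sub, show (fun k : ℕ => (k - ((n : ℝ) + 1) * p) * φ k) =
      fun k => (1 - p) * (k * φ k) - p * (((n : ℝ) + 1 - k) * φ k) from
      funext fun k => by ring, h]
  ring

lemma cast_sq (p : ℝ) (n : ℕ) :
    binomialMean p n (fun k => (k : ℝ) ^ 2) = (n * p) ^ 2 + n * p * (1 - p) := by
  cases n with
  | zero => simp [binomialMean]
  | succ n =>
    have hmean : binomialMean p n (fun k => (k : ℝ)) = n * p := by
      cases n with
      | zero => simp [binomialMean]
      | succ n =>
        have := succ_cast_mul p n (fun _ => 1)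
        rw [const] at this
        push_cast
        simpa using this
    simp only [sq]
    rw [succ_cast_mul]
    push_cast
    rw [add, hmean, const]
    ring

end binomialMean

/-- A comparison principle at `+∞` for the operator `u ↦ u' - x u`. -/
lemma nonneg_of_deriv_sub_mul_nonpos {d d' : ℝ → ℝ} (hd : ∀ x, 0 < x → HasDerivAt d (d' x) x)
    (hle : ∀ x, 0 < x → d' x - x * d x ≤ 0)
    (hlim : Filter.Tendsto (fun x => d x * Real.exp (-x ^ 2 / 2)) Filter.atTop (nhds 0))
    {x : ℝ} (hx : 0 < x) : 0 ≤ d x := by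
  have hderiv : ∀ y, 0 < y → HasDerivAt (fun x => d x * Real.exp (-x ^ 2 / 2))
      ((d' y - y * d y) * Real.exp (-y ^ 2 / 2)) y := by
    intro y hy
    have he : HasDerivAt (fun x : ℝ => Real.exp (-x ^ 2 / 2))
        (Real.exp (-y ^ 2 / 2) * (-(2 * y) / 2)) y := by
      simpa using ((hasDerivAt_pow 2 y).fun_neg.div_const 2).exp
    refine ((hd y hy).fun_mul he).congr_deriv ?_
    ring
  have hanti : AntitoneOn (fun x => d x * Real.exp (-x ^ 2 / 2)) (Ioi 0) := by
    refine antitoneOn_of_deriv_nonpos (convex_Ioi 0)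
      (fun y hy => (hderiv y hy).continuousAt.continuousWithinAt)
      (fun y hy => (hderiv y (interior_subset hy)).differentiableAt.differentiableWithinAt) ?_
    intro y hy
    have hy : 0 < y := interior_subset hy
    rw [(hderiv y hy).deriv]
    exact mul_nonpos_of_nonpos_of_nonneg (hle y hy) (Real.exp_nonneg _)
  have h : 0 ≤ d x * Real.exp (-x ^ 2 / 2) := by
    refine le_of_tendsto hlim ?_
    filter_upwards [Filter.eventually_ge_atTop x] with y hy
    exact hanti hx (hx.trans_le hy) hy
  exact nonneg_of_mul_nonneg_left h (Real.exp_pos _)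

lemma abs_le_of_abs_deriv_sub_mul_le {u u' β β' : ℝ → ℝ}
    (hu : ∀ x, 0 < x → HasDerivAt u (u' x) x) (hβ : ∀ x, 0 < x → HasDerivAt β (β' x) x)
    (hle : ∀ x, 0 < x → |u' x - x * u x| ≤ x * β x - β' x)
    (hulim : Filter.Tendsto (fun x => u x * Real.exp (-x ^ 2 / 2)) Filter.atTop (nhds 0))
    (hβlim : Filter.Tendsto (fun x => β x * Real.exp (-x ^ 2 / 2)) Filter.atTop (nhds 0))
    {x : ℝ} (hx : 0 < x) : |u x| ≤ β x := by
  rw [abs_le]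
  constructor
  · have := nonneg_of_deriv_sub_mul_nonpos (d := fun y => β y + u y)
      (fun y hy => (hβ y hy).add (hu y hy))
      (fun y hy => by have := (abs_le.1 (hle y hy)).2; linarith)
      (by simpa [add_mul] using hβlim.add hulim) hx
    linarith
  · have := nonneg_of_deriv_sub_mul_nonpos (d := fun y => β y - u y)
      (fun y hy => (hβ y hy).sub (hu y hy))
      (fun y hy => by have := (abs_le.1 (hle y hy)).1; linarith)
      (by simpa [sub_mul] using hβlim.sub hulim) hx
    linarith

lemma tendsto_exp_neg_sq_div_two_atTop :
    Filter.Tendsto (fun x : ℝ => Real.exp (-x ^ 2 / 2)) Filter.atTop (nhds 0) := by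
  refine Real.tendsto_exp_atBot.comp ?_
  have := (Filter.tendsto_pow_atTop (α := ℝ) (two_ne_zero)).atTop_div_const (r := 2) (by norm_num)
  refine (Filter.tendsto_neg_atTop_atBot.comp this).congr fun x => ?_
  simp only [Function.comp]; ring

lemma tendsto_mul_exp_neg_sq_div_two_atTop :
    Filter.Tendsto (fun x : ℝ => x * Real.exp (-x ^ 2 / 2)) Filter.atTop (nhds 0) := by
  have h := tendsto_rpow_abs_mul_exp_neg_mul_sq_cocompact (a := 1 / 2) (by norm_num) 1
  have h2 := h.mono_left (show Filter.atTop ≤ Filter.cocompact ℝ from atTop_le_cocompact)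
  refine h2.congr' ?_
  filter_upwards [Filter.eventually_ge_atTop 0] with x hx
  rw [Real.rpow_one, abs_of_nonneg hx]
  congr 2; ring

lemma abs_le_three_of_abs_deriv_sub_mul_le {u u' : ℝ → ℝ} (hu : ∀ x, HasDerivAt u (u' x) x)
    (hle : ∀ x, |u' x - x * u x| ≤ |x| + 1)
    (hlim : Filter.Tendsto (fun x => u x * Real.exp (-x ^ 2 / 2)) Filter.atTop (nhds 0))
    {x : ℝ} (hx : 0 < x) : |u x| ≤ 3 := by
  have hβ : ∀ x : ℝ, 0 < x → HasDerivAt (fun x : ℝ => 2 + (1 + x)⁻¹) (-1 / (1 + x) ^ 2) x := by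
    intro x hx
    simpa using (((hasDerivAt_id x).const_add 1).inv (by simp; linarith)).const_add 2
  have h1 : |u x| ≤ 2 + (1 + x)⁻¹ := by
    refine abs_le_of_abs_deriv_sub_mul_le (β := fun x : ℝ => 2 + (1 + x)⁻¹) (fun x _ => hu x) hβ
      ?_ hlim ?_ hx
    · intro x hx
      refine (hle x).trans ?_
      rw [abs_of_pos hx, ← sub_nonneg]
      have : x * (2 + (1 + x)⁻¹) - -1 / (1 + x) ^ 2 - (x + 1) =
          (2 * x ^ 2 + x ^ 3) / (1 + x) ^ 2 := by
        field_simp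
        ring
      rw [this]
      positivity
    · have h0 : Filter.Tendsto (fun x : ℝ => 2 + (1 + x)⁻¹) Filter.atTop (nhds (2 + 0)) :=
        (tendsto_inv_atTop_zero.comp
          (Filter.tendsto_atTop_add_const_left _ 1 Filter.tendsto_id)).const_add 2
      simpa using h0.mul tendsto_exp_neg_sq_div_two_atTop
  have : (1 + x)⁻¹ ≤ 1 := inv_le_one_of_one_le₀ (by linarith)
  linarith

lemma mul_abs_le_of_abs_deriv_sub_mul_le {u u' : ℝ → ℝ} {K : ℝ} (hK : 0 ≤ K)
    (hu : ∀ x, HasDerivAt u (u' x) x) (hle : ∀ x, |u' x - x * u x| ≤ K)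
    (hlim : Filter.Tendsto (fun x => u x * Real.exp (-x ^ 2 / 2)) Filter.atTop (nhds 0))
    {x : ℝ} (hx : 0 < x) : x * |u x| ≤ K := by
  have h1 : |u x| ≤ K * x⁻¹ := by
    refine abs_le_of_abs_deriv_sub_mul_le (β := fun x : ℝ => K * x⁻¹) (fun x _ => hu x)
      (fun x hx => (hasDerivAt_inv hx.ne').const_mul K) ?_ hlim ?_ hx
    · intro x hx
      refine (hle x).trans ?_
      rw [mul_left_comm, mul_inv_cancel₀ hx.ne']
      have : 0 ≤ K * (x ^ 2)⁻¹ := by positivity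
      linarith
    · simpa using (tendsto_inv_atTop_zero.const_mul K).mul tendsto_exp_neg_sq_div_two_atTop
  calc x * |u x| ≤ x * (K * x⁻¹) := mul_le_mul_of_nonneg_left h1 hx.le
    _ = K := by field_simp

lemma integrable_abs_gaussianReal : Integrable (fun x : ℝ => |x|) (gaussianReal 0 1) :=
  ((memLp_id_gaussianReal (μ := 0) (v := 1) 1).integrable le_rfl).abs

lemma integral_abs_gaussianReal_le_one : ∫ x, |x| ∂gaussianReal 0 1 ≤ 1 := by
  have h2 : Integrable (fun x : ℝ => x ^ 2) (gaussianReal 0 1) :=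
    (memLp_id_gaussianReal (μ := 0) (v := 1) 2).integrable_sq
  have hv : ∫ x, x ^ 2 ∂gaussianReal 0 1 = 1 := by
    have := variance_id_gaussianReal (μ := 0) (v := 1)
    rw [variance_eq_integral measurable_id.aemeasurable] at this
    simpa using this
  calc ∫ x, |x| ∂gaussianReal 0 1 ≤ ∫ x, (x ^ 2 + 1) / 2 ∂gaussianReal 0 1 := by
        refine integral_mono integrable_abs_gaussianReal
          ((h2.add (integrable_const 1)).div_const 2) fun x => ?_
        have := sq_nonneg (|x| - 1)
        rw [sub_sq, sq_abs] at this
        simp only []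
        linarith
    _ = 1 := by
        rw [integral_div, integral_add h2 (integrable_const 1), hv]
        norm_num

lemma LipschitzWith.abs_sub_le_abs_sub {h : ℝ → ℝ} (hh : LipschitzWith 1 h) (x y : ℝ) :
    |h x - h y| ≤ |x - y| := by
  simpa [Real.dist_eq] using hh.dist_le_mul x y

lemma integrable_gaussianReal_of_lipschitz {h : ℝ → ℝ} (hh : LipschitzWith 1 h) (a b : ℝ) :
    Integrable (fun z => h (a + b * z)) (gaussianReal 0 1) := by
  have hc := hh.continuous
  refine ((integrable_abs_gaussianReal.const_mul |b|).add (integrable_const |h a|)).mono'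
    (by fun_prop) (ae_of_all _ fun z => ?_)
  have h1 := hh.abs_sub_le_abs_sub (a + b * z) a
  rw [add_sub_cancel_left, abs_mul] at h1
  have h2 := abs_add_le (h (a + b * z) - h a) (h a)
  rw [sub_add_cancel] at h2
  simp only [Real.norm_eq_abs, Pi.add_apply]
  linarith

lemma abs_sub_integral_gaussianReal_le {h : ℝ → ℝ} (hh : LipschitzWith 1 h) (x : ℝ) :
    |h x - ∫ z, h z ∂gaussianReal 0 1| ≤ |x| + 1 := by
  have hi : Integrable h (gaussianReal 0 1) := by
    simpa using integrable_gaussianReal_of_lipschitz hh 0 1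
  have h1 : h x - ∫ z, h z ∂gaussianReal 0 1 = ∫ z, (h x - h z) ∂gaussianReal 0 1 := by
    rw [integral_sub (integrable_const _) hi]
    simp
  rw [h1]
  calc |∫ z, (h x - h z) ∂gaussianReal 0 1| ≤ ∫ z, (|x| + |z|) ∂gaussianReal 0 1 := by
        rw [← Real.norm_eq_abs]
        refine norm_integral_le_of_norm_le ((integrable_const _).add integrable_abs_gaussianReal)
          (ae_of_all _ fun z => ?_)
        exact (hh.abs_sub_le_abs_sub x z).trans (abs_sub _ _)
    _ ≤ |x| + 1 := by
        rw [integral_add (integrable_const _) integrable_abs_gaussianReal]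
        simpa using integral_abs_gaussianReal_le_one

lemma integrable_mul_exp_neg_sq_div_two {H : ℝ → ℝ} (hc : Continuous H)
    (hb : ∀ x, |H x| ≤ |x| + 1) : Integrable (fun x => H x * Real.exp (-x ^ 2 / 2)) := by
  have h1 := (integrable_mul_exp_neg_mul_sq (b := 1 / 2) (by norm_num)).abs
  have h2 := integrable_exp_neg_mul_sq (b := 1 / 2) (by norm_num)
  refine (h1.add h2).mono' (by fun_prop) (ae_of_all _ fun x => ?_)
  have he : Real.exp (-(1 / 2) * x ^ 2) = Real.exp (-x ^ 2 / 2) := by congr 1; ring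
  simp only [Real.norm_eq_abs, Pi.add_apply, abs_mul, he, Real.abs_exp]
  have := mul_le_mul_of_nonneg_right (hb x) (Real.exp_nonneg (-x ^ 2 / 2))
  linarith

lemma integral_sub_mul_exp_neg_sq_div_two {h : ℝ → ℝ} (hi : Integrable h (gaussianReal 0 1)) :
    ∫ x, (h x - ∫ z, h z ∂gaussianReal 0 1) * Real.exp (-x ^ 2 / 2) = 0 := by
  have h0 : ∫ x, (h x - ∫ z, h z ∂gaussianReal 0 1) ∂gaussianReal 0 1 = 0 := by
    rw [integral_sub hi (integrable_const _)]
    simp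
  rw [integral_gaussianReal_eq_integral_smul one_ne_zero] at h0
  simp only [gaussianPDFReal_def, smul_eq_mul, NNReal.coe_one, mul_one, sub_zero, mul_assoc] at h0
  rw [integral_const_mul] at h0
  have hpi : (√(2 * Real.pi))⁻¹ ≠ 0 := by positivity
  simpa only [mul_comm] using (mul_eq_zero.1 h0).resolve_left hpi

lemma tendsto_reflect_mul_exp {u : ℝ → ℝ}
    (h : Filter.Tendsto (fun x => u x * Real.exp (-x ^ 2 / 2)) Filter.atBot (nhds 0)) :
    Filter.Tendsto (fun x => -u (-x) * Real.exp (-x ^ 2 / 2)) Filter.atTop (nhds 0) := by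
  simpa [Function.comp_def] using (h.comp Filter.tendsto_neg_atTop_atBot).neg

lemma hasDerivAt_reflect {u u' : ℝ → ℝ} (hu : ∀ x, HasDerivAt u (u' x) x) (x : ℝ) :
    HasDerivAt (fun x => -u (-x)) (u' (-x)) x := by
  simpa using ((hu (-x)).comp x (hasDerivAt_neg x)).fun_neg

lemma abs_le_three_of_abs_deriv_sub_mul_le_of_tendsto {u u' : ℝ → ℝ}
    (hu : ∀ x, HasDerivAt u (u' x) x) (hle : ∀ x, |u' x - x * u x| ≤ |x| + 1)
    (htop : Filter.Tendsto (fun x => u x * Real.exp (-x ^ 2 / 2)) Filter.atTop (nhds 0))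
    (hbot : Filter.Tendsto (fun x => u x * Real.exp (-x ^ 2 / 2)) Filter.atBot (nhds 0))
    (x : ℝ) : |u x| ≤ 3 := by
  rcases lt_trichotomy x 0 with hx | rfl | hx
  · have := abs_le_three_of_abs_deriv_sub_mul_le (hasDerivAt_reflect hu)
      (fun y => by simpa using hle (-y)) (tendsto_reflect_mul_exp hbot) (neg_pos.2 hx)
    simpa using this
  · refine le_of_tendsto ((hu 0).continuousAt.abs.tendsto.mono_left
      (nhdsWithin_le_nhds (s := Ioi 0))) ?_
    filter_upwards [self_mem_nhdsWithin] with y hy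
    exact abs_le_three_of_abs_deriv_sub_mul_le hu hle htop hy
  · exact abs_le_three_of_abs_deriv_sub_mul_le hu hle htop hx

lemma abs_mul_le_of_abs_deriv_sub_mul_le_of_tendsto {u u' : ℝ → ℝ} {K : ℝ} (hK : 0 ≤ K)
    (hu : ∀ x, HasDerivAt u (u' x) x) (hle : ∀ x, |u' x - x * u x| ≤ K)
    (htop : Filter.Tendsto (fun x => u x * Real.exp (-x ^ 2 / 2)) Filter.atTop (nhds 0))
    (hbot : Filter.Tendsto (fun x => u x * Real.exp (-x ^ 2 / 2)) Filter.atBot (nhds 0))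
    (x : ℝ) : |x * u x| ≤ K := by
  rcases lt_trichotomy x 0 with hx | rfl | hx
  · have := mul_abs_le_of_abs_deriv_sub_mul_le hK (hasDerivAt_reflect hu)
      (fun y => by simpa using hle (-y)) (tendsto_reflect_mul_exp hbot) (neg_pos.2 hx)
    simpa [abs_mul, abs_of_neg hx] using this
  · simpa using hK
  · simpa [abs_mul, abs_of_pos hx] using mul_abs_le_of_abs_deriv_sub_mul_le hK hu hle htop hx

/-- A solution of the Gaussian Stein equation with Lipschitz derivative. -/
lemma exists_stein_solution {h h' : ℝ → ℝ} (hd : ∀ x, HasDerivAt h (h' x) x)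
    (hb : ∀ x, |h' x| ≤ 1) (hh : LipschitzWith 1 h) :
    ∃ f f' : ℝ → ℝ, (∀ x, HasDerivAt f (f' x) x) ∧
      (∀ x, f' x - x * f x = h x - ∫ z, h z ∂gaussianReal 0 1) ∧
      ∀ x y, |f' x - f' y| ≤ 8 * |x - y| := by
  set H : ℝ → ℝ := fun x => h x - ∫ z, h z ∂gaussianReal 0 1 with hH
  have hc := hh.continuous
  have hHc : Continuous H := by fun_prop
  have hHb : ∀ x, |H x| ≤ |x| + 1 := abs_sub_integral_gaussianReal_le hh
  have hi : Integrable h (gaussianReal 0 1) := by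
    simpa using integrable_gaussianReal_of_lipschitz hh 0 1
  have hint := integrable_mul_exp_neg_sq_div_two hHc hHb
  have hzero : ∫ x, H x * Real.exp (-x ^ 2 / 2) = 0 := integral_sub_mul_exp_neg_sq_div_two hi
  have hsplit := intervalIntegral.integral_Iic_add_Ioi (b := 0) hint.integrableOn hint.integrableOn
  rw [hzero] at hsplit
  set A : ℝ := ∫ x in Iic 0, H x * Real.exp (-x ^ 2 / 2)
  set v : ℝ → ℝ := fun x => A + ∫ y in (0 : ℝ)..x, H y * Real.exp (-y ^ 2 / 2) with hv
  have hcancel : ∀ x : ℝ, Real.exp (x ^ 2 / 2) * Real.exp (-x ^ 2 / 2) = 1 := fun x => by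
    rw [← Real.exp_add, show x ^ 2 / 2 + -x ^ 2 / 2 = 0 by ring, Real.exp_zero]
  set f : ℝ → ℝ := fun x => v x * Real.exp (x ^ 2 / 2) with hf
  set f' : ℝ → ℝ := fun x => x * f x + H x with hf'
  have hfv : ∀ x, f x * Real.exp (-x ^ 2 / 2) = v x := fun x => by
    rw [hf, mul_assoc, hcancel, mul_one]
  have hder : ∀ x, HasDerivAt f (f' x) x := by
    intro x
    have h1 : HasDerivAt v (H x * Real.exp (-x ^ 2 / 2)) x := by
      have hcont : Continuous fun y => H y * Real.exp (-y ^ 2 / 2) := by fun_prop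
      exact (hcont.integral_hasStrictDerivAt 0 x).hasDerivAt.const_add A
    have h2 : HasDerivAt (fun x : ℝ => Real.exp (x ^ 2 / 2))
        (Real.exp (x ^ 2 / 2) * (2 * x / 2)) x := by
      simpa using ((hasDerivAt_pow 2 x).div_const 2).exp
    refine (h1.fun_mul h2).congr_deriv ?_
    simp only [hf', hf]
    linear_combination H x * hcancel x
  have hvtop : Filter.Tendsto v Filter.atTop (nhds 0) := by
    rw [← hsplit]
    exact (intervalIntegral_tendsto_integral_Ioi 0 hint.integrableOn Filter.tendsto_id).const_add A
  have hvbot : Filter.Tendsto v Filter.atBot (nhds 0) := by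
    have := (intervalIntegral_tendsto_integral_Iic 0 hint.integrableOn
      Filter.tendsto_id).const_sub A
    rw [sub_self] at this
    refine this.congr fun x => ?_
    rw [hv, intervalIntegral.integral_symm, id, sub_neg_eq_add]
  have hfb : ∀ x, |f x| ≤ 3 := by
    refine abs_le_three_of_abs_deriv_sub_mul_le_of_tendsto hder (fun x => ?_) ?_ ?_
    · simpa [hf'] using hHb x
    · simpa only [hfv] using hvtop
    · simpa only [hfv] using hvbot
  have hder' : ∀ x, HasDerivAt f' (f x + x * f' x + h' x) x := by
    intro x
    refine (((hasDerivAt_id x).fun_mul (hder x)).add ((hd x).sub_const _)).congr_deriv ?_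
    simp
  have hk : ∀ x, |f x + h' x| ≤ 4 := fun x =>
    (abs_add_le _ _).trans (by linarith [hfb x, hb x])
  have hf'top : Filter.Tendsto (fun x => (4 * |x| + 1) * Real.exp (-x ^ 2 / 2))
      Filter.atTop (nhds 0) := by
    have := (tendsto_mul_exp_neg_sq_div_two_atTop.const_mul 4).add tendsto_exp_neg_sq_div_two_atTop
    simp only [mul_zero, add_zero] at this
    refine this.congr' ?_
    filter_upwards [Filter.eventually_ge_atTop 0] with x hx
    rw [abs_of_nonneg hx]; ring
  have hf'bot : Filter.Tendsto (fun x => (4 * |x| + 1) * Real.exp (-x ^ 2 / 2))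
      Filter.atBot (nhds 0) := by
    simpa [Function.comp_def] using hf'top.comp Filter.tendsto_neg_atBot_atTop
  have hf'le : ∀ x, ‖f' x * Real.exp (-x ^ 2 / 2)‖ ≤ (4 * |x| + 1) * Real.exp (-x ^ 2 / 2) := by
    intro x
    rw [Real.norm_eq_abs, abs_mul, Real.abs_exp]
    refine mul_le_mul_of_nonneg_right ?_ (Real.exp_nonneg _)
    refine (abs_add_le _ _).trans ?_
    rw [abs_mul]
    have := mul_le_mul_of_nonneg_left (hfb x) (abs_nonneg x)
    linarith [hHb x]
  have hxf' : ∀ x, |x * f' x| ≤ 4 := by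
    refine abs_mul_le_of_abs_deriv_sub_mul_le_of_tendsto (by norm_num) hder' (fun x => ?_)
      (squeeze_zero_norm hf'le hf'top) (squeeze_zero_norm hf'le hf'bot)
    convert hk x using 2
    ring
  refine ⟨f, f', hder, fun x => by simp [hf', hH], fun x y => ?_⟩
  have := Convex.norm_image_sub_le_of_norm_hasDerivWithin_le (s := univ) (C := 8)
    (fun x _ => (hder' x).hasDerivWithinAt) (fun x _ => ?_) convex_univ (mem_univ y) (mem_univ x)
  · simpa using this
  · rw [Real.norm_eq_abs, show f x + x * f' x + h' x = (f x + h' x) + x * f' x by ring]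
    exact (abs_add_le _ _).trans (by linarith [hk x, hxf' x])

/-- A Berry–Esseen bound in Wasserstein distance for the binomial law, smooth test functions. -/
lemma abs_binomialMean_sub_integral_le_of_hasDerivAt {h h' : ℝ → ℝ}
    (hd : ∀ x, HasDerivAt h (h' x) x) (hb : ∀ x, |h' x| ≤ 1) (hh : LipschitzWith 1 h)
    {p : ℝ} (hp : p ∈ Ioo (0 : ℝ) 1) (n : ℕ) :
    |binomialMean p (n + 1) (fun k => h k) -
      ∫ z, h ((n + 1) * p + √((n + 1) * p * (1 - p)) * z) ∂gaussianReal 0 1| ≤ 8 := by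
  obtain ⟨hp0, hp1⟩ := hp
  have hq : 0 < 1 - p := sub_pos.2 hp1
  set m : ℝ := (n + 1) * p
  set σ : ℝ := √((n + 1) * p * (1 - p)) with hσ
  have hσ0 : 0 < σ := Real.sqrt_pos.2 (by positivity)
  have hσ2 : σ ^ 2 = (n + 1) * p * (1 - p) := Real.sq_sqrt (by positivity)
  have hgd : ∀ x, HasDerivAt (fun x => h (m + σ * x) / σ) (h' (m + σ * x)) x := by
    intro x
    have h1 : HasDerivAt (fun x => m + σ * x) σ x := by
      simpa using ((hasDerivAt_id x).const_mul σ).const_add m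
    refine (((hd (m + σ * x)).comp x h1).div_const σ).congr_deriv ?_
    field_simp
  have hgL : LipschitzWith 1 (fun x => h (m + σ * x) / σ) := by
    refine LipschitzWith.of_dist_le_mul fun x y => ?_
    have := hh.abs_sub_le_abs_sub (m + σ * x) (m + σ * y)
    rw [show m + σ * x - (m + σ * y) = σ * (x - y) by ring, abs_mul, abs_of_pos hσ0] at this
    rw [Real.dist_eq, Real.dist_eq, ← sub_div, abs_div, abs_of_pos hσ0, div_le_iff₀ hσ0]
    simpa [mul_comm] using this
  obtain ⟨f, f', hf, hstein, hlip⟩ := exists_stein_solution hgd (fun x => hb _) hgL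
  rw [integral_div] at hstein
  set N : ℝ := ∫ z, h (m + σ * z) ∂gaussianReal 0 1
  set w : ℝ → ℝ := fun k => (k - m) / σ with hw
  have hwadd : ∀ k, w (k + 1) - w k = 1 / σ := fun k => by simp only [hw]; ring
  have hpt : ∀ k : ℕ, h k - N = σ * f' (w k) - (k - m) * f (w k) := by
    intro k
    have := hstein (w k)
    have hk : m + σ * w k = k := by simp only [hw]; field_simp; ring
    simp only [hk] at this
    have h2 : (k : ℝ) - m = σ * w k := by linarith
    rw [h2]
    field_simp at this
    linear_combination -this
  have hmean : binomialMean p (n + 1) (fun k => h k) - N =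
      binomialMean p n (fun k => σ * (p * f' (w (k + 1)) + (1 - p) * f' (w k)) -
        σ ^ 2 * (f (w (k + 1)) - f (w k))) := by
    calc binomialMean p (n + 1) (fun k => h k) - N
        = binomialMean p (n + 1) (fun k => h k - N) := by
          rw [binomialMean.sub, binomialMean.const]
      _ = binomialMean p (n + 1) (fun k => σ * f' (w k) - (k - ((n : ℝ) + 1) * p) * f (w k)) := by
          simp only [hpt]
          rfl
      _ = _ := by
          rw [binomialMean.sub, binomialMean.sub, binomialMean.const_mul, binomialMean.const_mul,
            binomialMean.const_mul, binomialMean.succ,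
            binomialMean.succ_centered_mul p n (fun k => f (w k)), hσ2]
          push_cast
          rfl
  rw [hmean]
  refine binomialMean.abs_le ⟨hp0.le, hp1.le⟩ n fun k => ?_
  have hlt : w k < w (k + 1) := by
    have := hwadd k
    have : 0 < 1 / σ := by positivity
    linarith
  obtain ⟨c, ⟨hc1, hc2⟩, hc⟩ := exists_hasDerivAt_eq_slope f f' hlt
    (fun x _ => (hf x).continuousAt.continuousWithinAt) fun x _ => hf x
  rw [hwadd, div_div_eq_mul_div, div_one] at hc
  have e1 : |f' (w (k + 1)) - f' c| ≤ 8 / σ := by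
    refine (hlip _ _).trans ?_
    rw [abs_of_pos (sub_pos.2 hc2)]
    have := hwadd k
    rw [show 8 / σ = 8 * (1 / σ) by ring]
    linarith
  have e2 : |f' (w k) - f' c| ≤ 8 / σ := by
    refine (hlip _ _).trans ?_
    rw [abs_sub_comm, abs_of_pos (sub_pos.2 hc1)]
    have := hwadd k
    rw [show 8 / σ = 8 * (1 / σ) by ring]
    linarith
  rw [show σ * (p * f' (w (k + 1)) + (1 - p) * f' (w k)) - σ ^ 2 * (f (w (k + 1)) - f (w k)) =
    σ * (p * (f' (w (k + 1)) - f' c) + (1 - p) * (f' (w k) - f' c)) by rw [hc]; ring, abs_mul,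
    abs_of_pos hσ0]
  calc σ * |p * (f' (w (k + 1)) - f' c) + (1 - p) * (f' (w k) - f' c)|
      ≤ σ * (p * (8 / σ) + (1 - p) * (8 / σ)) := by
        refine mul_le_mul_of_nonneg_left ((abs_add_le _ _).trans ?_) hσ0.le
        rw [abs_mul, abs_mul, abs_of_pos hp0, abs_of_pos hq]
        gcongr
    _ = 8 := by field_simp; ring

/-- A Lipschitz function lies within distance one of a smooth Lipschitz function. -/
lemma LipschitzWith.exists_hasDerivAt_abs_sub_le {h : ℝ → ℝ} (hh : LipschitzWith 1 h) :
    ∃ g g' : ℝ → ℝ, (∀ x, HasDerivAt g (g' x) x) ∧ (∀ x, |g' x| ≤ 1) ∧ LipschitzWith 1 g ∧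
      ∀ x, |h x - g x| ≤ 1 := by
  have hc := hh.continuous
  have hii : ∀ a b : ℝ, IntervalIntegrable h volume a b := hc.intervalIntegrable
  set G : ℝ → ℝ := fun x => ∫ y in (0 : ℝ)..x, h y
  have hG : ∀ x, HasDerivAt G (h x) x := fun x => (hc.integral_hasStrictDerivAt 0 x).hasDerivAt
  have hder : ∀ x, HasDerivAt (fun x => G (x + 1) - G x) (h (x + 1) - h x) x := fun x =>
    ((hG (x + 1)).comp_add_const x 1).sub (hG x)
  have hb : ∀ x, |h (x + 1) - h x| ≤ 1 := fun x => by
    simpa using hh.abs_sub_le_abs_sub (x + 1) x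
  refine ⟨fun x => G (x + 1) - G x, fun x => h (x + 1) - h x, hder, hb, ?_, fun x => ?_⟩
  · refine LipschitzWith.of_dist_le_mul fun x y => ?_
    have := Convex.norm_image_sub_le_of_norm_hasDerivWithin_le (s := univ) (C := 1)
      (fun x _ => (hder x).hasDerivWithinAt) (fun x _ => hb x) convex_univ (mem_univ y) (mem_univ x)
    rw [Real.dist_eq, Real.dist_eq, NNReal.coe_one]
    exact this
  · have h1 : h x - (G (x + 1) - G x) = ∫ y in x..(x + 1), (h x - h y) := by
      rw [intervalIntegral.integral_sub (by simp) (hii _ _),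
        ← intervalIntegral.integral_interval_sub_left (hii 0 (x + 1)) (hii 0 x)]
      simp [G]
    rw [h1, ← Real.norm_eq_abs]
    have := intervalIntegral.norm_integral_le_of_norm_le_const (a := x) (b := x + 1) (C := 1)
      (f := fun y => h x - h y) fun y hy => ?_
    · simpa using this
    · rw [uIoc_of_le (by linarith)] at hy
      refine (hh.abs_sub_le_abs_sub x y).trans ?_
      rw [abs_le]
      constructor <;> linarith [hy.1, hy.2]

/-- A Berry–Esseen bound in Wasserstein distance for the binomial law. -/
lemma abs_binomialMean_sub_integral_le {h : ℝ → ℝ} (hh : LipschitzWith 1 h)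
    {p : ℝ} (hp : p ∈ Ioo (0 : ℝ) 1) (n : ℕ) :
    |binomialMean p (n + 1) (fun k => h k) -
      ∫ z, h ((n + 1) * p + √((n + 1) * p * (1 - p)) * z) ∂gaussianReal 0 1| ≤ 10 := by
  obtain ⟨g, g', hgd, hgb, hgL, hhg⟩ := hh.exists_hasDerivAt_abs_sub_le
  have h1 := abs_binomialMean_sub_integral_le_of_hasDerivAt hgd hgb hgL hp n
  have h2 : |binomialMean p (n + 1) (fun k => h k) -
      binomialMean p (n + 1) (fun k => g k)| ≤ 1 := by
    rw [← binomialMean.sub]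
    exact binomialMean.abs_le ⟨hp.1.le, hp.2.le⟩ _ fun k => hhg k
  set m : ℝ := (n + 1) * p
  set σ : ℝ := √((n + 1) * p * (1 - p))
  have h3 : |(∫ z, h (m + σ * z) ∂gaussianReal 0 1) -
      ∫ z, g (m + σ * z) ∂gaussianReal 0 1| ≤ 1 := by
    rw [← integral_sub (integrable_gaussianReal_of_lipschitz hh m σ)
      (integrable_gaussianReal_of_lipschitz hgL m σ), ← Real.norm_eq_abs]
    have := norm_integral_le_of_norm_le_const (μ := gaussianReal 0 1) (C := 1)
      (f := fun z => h (m + σ * z) - g (m + σ * z)) (ae_of_all _ fun z => hhg (m + σ * z))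
    simpa using this
  rw [abs_le] at *
  constructor <;> linarith

/-- The rescaled version of `abs_binomialMean_sub_integral_le`. -/
lemma abs_binomialMean_div_sub_integral_le {φ : ℝ → ℝ} (hφ : LipschitzWith 1 φ)
    {p : ℝ} (hp : p ∈ Ioo (0 : ℝ) 1) {n : ℕ} (hn : 1 ≤ n) :
    |binomialMean p n (fun k => φ (k / n)) -
      ∫ z, φ (p + √(p * (1 - p) / n) * z) ∂gaussianReal 0 1| ≤ 10 / n := by
  obtain ⟨n, rfl⟩ := Nat.exists_eq_add_of_le' hn
  set N : ℝ := ((n + 1 : ℕ) : ℝ) with hN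
  have hN0 : 0 < N := by positivity
  have hhL : LipschitzWith 1 (fun x => N * φ (x / N)) := by
    refine LipschitzWith.of_dist_le_mul fun x y => ?_
    have := hφ.abs_sub_le_abs_sub (x / N) (y / N)
    rw [← sub_div, abs_div, abs_of_pos hN0, le_div_iff₀ hN0] at this
    rw [Real.dist_eq, Real.dist_eq, ← mul_sub, abs_mul, abs_of_pos hN0]
    simpa [mul_comm] using this
  have key := abs_binomialMean_sub_integral_le hhL hp n
  rw [binomialMean.const_mul, integral_const_mul, ← mul_sub, abs_mul, abs_of_pos hN0] at key
  rw [le_div_iff₀ hN0, mul_comm]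
  have hN' : (n : ℝ) + 1 = N := by simp [hN]
  have hs : √(p * (1 - p) / N) = √(N * p * (1 - p)) / N := by
    have : 0 ≤ p * (1 - p) := mul_nonneg hp.1.le (sub_nonneg.2 hp.2.le)
    rw [eq_div_iff hN0.ne', ← sq_eq_sq₀ (by positivity) (by positivity), mul_pow,
      Real.sq_sqrt (by positivity), Real.sq_sqrt (by rw [mul_assoc]; positivity)]
    field_simp
  have hz : ∀ z, p + √(p * (1 - p) / N) * z = ((n + 1) * p + √((n + 1) * p * (1 - p)) * z) / N := by
    intro z
    rw [hs, hN']
    field_simp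
  simpa only [hz] using key

lemma integral_cos_add_mul_gaussianReal (t s : ℝ) :
    ∫ z, Real.cos (t + s * z) ∂gaussianReal 0 1 = Real.cos t * Real.exp (-s ^ 2 / 2) := by
  have h := charFun_gaussianReal (μ := 0) (v := 1) s
  rw [charFun_apply_real] at h
  have h2 : ∫ z : ℝ, Complex.exp (t * Complex.I) * Complex.exp (s * z * Complex.I)
      ∂gaussianReal 0 1 = Complex.exp (t * Complex.I) * ((Real.exp (-s ^ 2 / 2) : ℝ) : ℂ) := by
    rw [integral_const_mul, h]
    congr 1
    push_cast
    congr 1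
    simp
    ring
  have hi : Integrable (fun z : ℝ => Complex.exp (t * Complex.I) * Complex.exp (s * z * Complex.I))
      (gaussianReal 0 1) := by
    refine Integrable.of_bound (by fun_prop) 1 (ae_of_all _ fun z => ?_)
    rw [norm_mul, Complex.norm_exp_ofReal_mul_I, ← Complex.ofReal_mul,
      Complex.norm_exp_ofReal_mul_I, one_mul]
  have h3 := Complex.reCLM.integral_comp_comm hi
  rw [h2] at h3
  simp only [Complex.reCLM_apply, Complex.re_mul_ofReal, Complex.exp_ofReal_mul_I_re] at h3
  rw [← h3]
  refine integral_congr_ae (ae_of_all _ fun z => ?_)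
  simp only []
  rw [← Complex.exp_add, ← add_mul, ← Complex.ofReal_mul, ← Complex.ofReal_add,
    Complex.exp_ofReal_mul_I_re]

section MixingMeasure

variable {μ : Measure ℝ} [IsProbabilityMeasure μ]

lemma integrable_of_continuous_of_ae_mem_Icc {g : ℝ → ℝ} (hg : Continuous g)
    (hμ : ∀ᵐ t ∂μ, t ∈ Icc (0 : ℝ) 1) : Integrable g μ := by
  obtain ⟨C, hC⟩ := isCompact_Icc.exists_bound_of_continuousOn
    (hg.continuousOn (s := Icc (0 : ℝ) 1))
  exact Integrable.of_bound hg.aestronglyMeasurable C (hμ.mono hC)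

lemma continuous_binomialMean (n : ℕ) (φ : ℕ → ℝ) :
    Continuous fun t => binomialMean t n φ := by
  unfold binomialMean
  fun_prop

lemma integral_barLaw_s4 (hμ : ∀ᵐ t ∂μ, t ∈ Icc (0 : ℝ) 1) (n : ℕ) (φ : ℝ → ℝ) :
    ∫ x, φ x ∂barLaw μ n = ∫ t, binomialMean t n (fun k => φ (k / n)) ∂μ := by
  unfold barLaw binomialMean
  rw [integral_finsetSum_measure, integral_finsetSum]
  · refine Finset.sum_congr rfl fun k _ => ?_
    have hnn : 0 ≤ ∫ t, t ^ k * (1 - t) ^ (n - k) ∂μ :=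
      integral_nonneg_of_ae <| hμ.mono fun t ht =>
        mul_nonneg (pow_nonneg ht.1 _) (pow_nonneg (sub_nonneg.2 ht.2) _)
    rw [integral_smul_measure, integral_dirac, ENNReal.toReal_ofReal (by positivity), smul_eq_mul,
      integral_mul_const]
    simp only [mul_assoc]
    rw [integral_const_mul]
    ring
  · exact fun k _ => integrable_of_continuous_of_ae_mem_Icc (by fun_prop) hμ
  · exact fun k _ => (integrable_dirac (by simp)).smul_measure ENNReal.ofReal_ne_top

lemma sqrt_mul_one_sub_div_le_one (t : ℝ) (n : ℕ) : √(t * (1 - t) / n) ≤ 1 := by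
  rw [Real.sqrt_le_one]
  rcases n.eq_zero_or_pos with rfl | hn
  · simp
  · have hn' : (1 : ℝ) ≤ n := by exact_mod_cast hn
    rw [div_le_one (by linarith)]
    nlinarith [sq_nonneg (t - 1 / 2)]

lemma integrable_perturbation (hμ : ∀ᵐ t ∂μ, t ∈ Icc (0 : ℝ) 1) (n : ℕ) {φ : ℝ → ℝ}
    (hφ : LipschitzWith 1 φ) :
    Integrable (fun q : ℝ × ℝ => φ (q.1 + √(q.1 * (1 - q.1) / n) * q.2))
      (μ.prod (gaussianReal 0 1)) := by
  have hc := hφ.continuous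
  have h1 : Integrable (fun q : ℝ × ℝ => φ q.1) (μ.prod (gaussianReal 0 1)) :=
    (integrable_of_continuous_of_ae_mem_Icc hc hμ).comp_fst _
  have h2 : Integrable (fun q : ℝ × ℝ => |q.2|) (μ.prod (gaussianReal 0 1)) :=
    integrable_abs_gaussianReal.comp_snd _
  refine (h1.abs.add h2).mono' (by fun_prop) (ae_of_all _ fun q => ?_)
  have h3 := hφ.abs_sub_le_abs_sub (q.1 + √(q.1 * (1 - q.1) / n) * q.2) q.1
  rw [add_sub_cancel_left, abs_mul, abs_of_nonneg (Real.sqrt_nonneg _)] at h3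
  have h4 := mul_le_mul_of_nonneg_right (sqrt_mul_one_sub_div_le_one q.1 n) (abs_nonneg q.2)
  have h5 := abs_sub_abs_le_abs_sub (φ (q.1 + √(q.1 * (1 - q.1) / n) * q.2)) (φ q.1)
  simp only [Real.norm_eq_abs, Pi.add_apply]
  linarith

lemma integral_perturbedLaw (hμ : ∀ᵐ t ∂μ, t ∈ Icc (0 : ℝ) 1) (n : ℕ) {φ : ℝ → ℝ}
    (hφ : LipschitzWith 1 φ) :
    ∫ x, φ x ∂perturbedLaw μ n =
      ∫ t, ∫ z, φ (t + √(t * (1 - t) / n) * z) ∂gaussianReal 0 1 ∂μ := by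
  unfold perturbedLaw
  rw [integral_map (by fun_prop) hφ.continuous.aestronglyMeasurable,
    integral_prod _ (integrable_perturbation hμ n hφ)]

lemma abs_integral_barLaw_sub_integral_perturbedLaw_le (hμ : ∀ᵐ t ∂μ, t ∈ Ioo (0 : ℝ) 1) {n : ℕ}
    (hn : 1 ≤ n) {φ : ℝ → ℝ} (hφ : LipschitzWith 1 φ) :
    |∫ x, φ x ∂barLaw μ n - ∫ x, φ x ∂perturbedLaw μ n| ≤ 10 / n := by
  have hμ' : ∀ᵐ t ∂μ, t ∈ Icc (0 : ℝ) 1 := hμ.mono fun t ht => Ioo_subset_Icc_self ht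
  rw [integral_barLaw_s4 hμ', integral_perturbedLaw hμ' n hφ, ← integral_sub
    (integrable_of_continuous_of_ae_mem_Icc (continuous_binomialMean n _) hμ')
    (integrable_perturbation hμ' n hφ).integral_prod_left, ← Real.norm_eq_abs]
  have := norm_integral_le_of_norm_le_const (μ := μ) (C := 10 / n)
    (f := fun t => binomialMean t n (fun k => φ (k / n)) -
      ∫ z, φ (t + √(t * (1 - t) / n) * z) ∂gaussianReal 0 1)
    (hμ.mono fun t ht => abs_binomialMean_div_sub_integral_le hφ ht hn)
  simpa using this

lemma abs_integral_perturbedLaw_sub_integral_le (hμ : ∀ᵐ t ∂μ, t ∈ Icc (0 : ℝ) 1) (n : ℕ)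
    {φ : ℝ → ℝ} (hφ : LipschitzWith 1 φ) :
    |∫ x, φ x ∂perturbedLaw μ n - ∫ x, φ x ∂μ| ≤ 1 := by
  rw [integral_perturbedLaw hμ n hφ, ← integral_sub
    (integrable_perturbation hμ n hφ).integral_prod_left
    (integrable_of_continuous_of_ae_mem_Icc hφ.continuous hμ), ← Real.norm_eq_abs]
  have := norm_integral_le_of_norm_le_const (μ := μ) (C := 1)
    (f := fun t => ∫ z, φ (t + √(t * (1 - t) / n) * z) ∂gaussianReal 0 1 - φ t)
    (ae_of_all _ fun t => ?_)
  · simpa using this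
  have h1 : ∫ z, φ (t + √(t * (1 - t) / n) * z) ∂gaussianReal 0 1 - φ t =
      ∫ z, (φ (t + √(t * (1 - t) / n) * z) - φ t) ∂gaussianReal 0 1 := by
    rw [integral_sub (integrable_gaussianReal_of_lipschitz hφ _ _) (integrable_const _)]
    simp
  rw [h1]
  refine (norm_integral_le_of_norm_le integrable_abs_gaussianReal (ae_of_all _ fun z => ?_)).trans
    integral_abs_gaussianReal_le_one
  have h3 := hφ.abs_sub_le_abs_sub (t + √(t * (1 - t) / n) * z) t
  rw [add_sub_cancel_left, abs_mul, abs_of_nonneg (Real.sqrt_nonneg _)] at h3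
  have h4 := mul_le_mul_of_nonneg_right (sqrt_mul_one_sub_div_le_one t n) (abs_nonneg z)
  rw [Real.norm_eq_abs]
  linarith

lemma integral_mul_one_sub_pos (hμ : ∀ᵐ t ∂μ, t ∈ Ioo (0 : ℝ) 1) : 0 < ∫ t, t * (1 - t) ∂μ := by
  have hpos : ∀ᵐ t ∂μ, 0 < t * (1 - t) :=
    hμ.mono fun t ht => mul_pos ht.1 (sub_pos.2 ht.2)
  have hi : Integrable (fun t : ℝ => t * (1 - t)) μ :=
    integrable_of_continuous_of_ae_mem_Icc (by fun_prop)
      (hμ.mono fun t ht => Ioo_subset_Icc_self ht)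
  rw [integral_pos_iff_support_of_nonneg_ae (hpos.mono fun t ht => ht.le) hi]
  have : μ (Function.support fun t : ℝ => t * (1 - t)) = 1 :=
    (mem_ae_iff_prob_eq_one (measurableSet_support (by fun_prop))).1 (hpos.mono fun t ht => ht.ne')
  rw [this]
  exact one_pos

lemma lipschitzWith_sq_clamp_div_two :
    LipschitzWith 1 (fun x : ℝ => (max 0 (min 1 x)) ^ 2 / 2) := by
  have hL : LipschitzWith 1 (fun x : ℝ => max 0 (min 1 x)) :=
    (LipschitzWith.id.const_min 1).const_max 0
  refine LipschitzWith.of_dist_le_mul fun x y => ?_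
  have h := hL.abs_sub_le_abs_sub x y
  rw [Real.dist_eq, Real.dist_eq, NNReal.coe_one, one_mul]
  refine le_trans ?_ h
  have h0 : ∀ x : ℝ, 0 ≤ max 0 (min 1 x) := fun x => le_max_left _ _
  have h1 : ∀ x : ℝ, max 0 (min 1 x) ≤ 1 := fun x => max_le zero_le_one (min_le_left _ _)
  set a := max 0 (min 1 x)
  set b := max 0 (min 1 y)
  have hab : |(a + b) / 2| ≤ 1 := by
    rw [abs_of_nonneg (by have := h0 x; have := h0 y; positivity)]
    linarith [h1 x, h1 y]
  calc |a ^ 2 / 2 - b ^ 2 / 2| = |(a + b) / 2| * |a - b| := by rw [← abs_mul]; congr 1; ring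
    _ ≤ 1 * |a - b| := mul_le_mul_of_nonneg_right hab (abs_nonneg _)
    _ = |a - b| := one_mul _

lemma exists_lipschitz_barLaw_ge (hμ : ∀ᵐ t ∂μ, t ∈ Icc (0 : ℝ) 1) {n : ℕ} (hn : 1 ≤ n) :
    ∃ φ : ℝ → ℝ, LipschitzWith 1 φ ∧
      (∫ t, t * (1 - t) ∂μ) / (2 * n) ≤ ∫ x, φ x ∂barLaw μ n - ∫ x, φ x ∂μ := by
  refine ⟨_, lipschitzWith_sq_clamp_div_two, ?_⟩
  have hn0 : (0 : ℝ) < n := by exact_mod_cast hn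
  have hclamp : ∀ x ∈ Icc (0 : ℝ) 1, max 0 (min 1 x) = x := fun x hx => by
    rw [min_eq_right hx.2, max_eq_right hx.1]
  rw [integral_barLaw_s4 hμ, ← integral_sub
    (integrable_of_continuous_of_ae_mem_Icc (continuous_binomialMean n _) hμ)
    (integrable_of_continuous_of_ae_mem_Icc (by fun_prop) hμ), ← integral_div]
  refine le_of_eq (integral_congr_ae (hμ.mono fun t ht => ?_))
  have h1 : binomialMean t n (fun k => (max 0 (min 1 ((k : ℝ) / n))) ^ 2 / 2) =
      binomialMean t n (fun k => 1 / (2 * n ^ 2) * (k : ℝ) ^ 2) := by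
    refine Finset.sum_congr rfl fun k hk => ?_
    have hk : (k : ℝ) ≤ n := by exact_mod_cast Nat.lt_succ_iff.1 (Finset.mem_range.1 hk)
    simp only []
    rw [hclamp _ ⟨by positivity, (div_le_one hn0).2 hk⟩]
    field_simp
  simp only []
  rw [h1, binomialMean.const_mul, binomialMean.cast_sq, hclamp t ht]
  field_simp
  ring

lemma exists_lipschitz_perturbedLaw_ge (hμ : ∀ᵐ t ∂μ, t ∈ Icc (0 : ℝ) 1) {n : ℕ} (hn : 1 ≤ n) :
    ∃ φ : ℝ → ℝ, LipschitzWith 1 φ ∧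
      Real.cos 1 * (∫ t, t * (1 - t) ∂μ) / (4 * n) ≤
        ∫ x, φ x ∂μ - ∫ x, φ x ∂perturbedLaw μ n := by
  have hcos : LipschitzWith 1 Real.cos := Real.lipschitzWith_cos
  refine ⟨Real.cos, hcos, ?_⟩
  have hn1 : (1 : ℝ) ≤ n := by exact_mod_cast hn
  rw [integral_perturbedLaw hμ n hcos, ← integral_sub
    (integrable_of_continuous_of_ae_mem_Icc hcos.continuous hμ)
    (integrable_perturbation hμ n hcos).integral_prod_left, ← integral_const_mul, ← integral_div]
  refine integral_mono_ae (integrable_of_continuous_of_ae_mem_Icc (by fun_prop) hμ)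
    ((integrable_of_continuous_of_ae_mem_Icc hcos.continuous hμ).sub
    (integrable_perturbation hμ n hcos).integral_prod_left) (hμ.mono fun t ht => ?_)
  simp only []
  have hv : 0 ≤ t * (1 - t) := mul_nonneg ht.1 (sub_nonneg.2 ht.2)
  rw [integral_cos_add_mul_gaussianReal, Real.sq_sqrt (by positivity)]
  set y : ℝ := t * (1 - t) / n / 2 with hy
  have hy0 : 0 ≤ y := by positivity
  have hy1 : y ≤ 1 := by
    have : t * (1 - t) / n ≤ 1 := by
      rw [div_le_one (by linarith)]
      nlinarith [sq_nonneg (t - 1 / 2)]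
    linarith
  have hexp : y / 2 ≤ 1 - Real.exp (-(t * (1 - t) / n) / 2) := by
    have h1 : Real.exp (-(t * (1 - t) / n) / 2) ≤ (1 + y)⁻¹ := by
      rw [neg_div, ← hy, Real.exp_neg]
      exact inv_anti₀ (by positivity) (by linarith [Real.add_one_le_exp y])
    have h2 : (1 + y)⁻¹ ≤ 1 - y / 2 := by
      rw [inv_le_iff_one_le_mul₀ (by positivity)]
      nlinarith
    linarith
  have hc : Real.cos 1 ≤ Real.cos t :=
    Real.cos_le_cos_of_nonneg_of_le_pi ht.1 (by linarith [Real.pi_gt_three]) ht.2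
  calc Real.cos 1 * (t * (1 - t)) / (4 * n) = Real.cos 1 * (y / 2) := by rw [hy]; ring
    _ ≤ Real.cos t * (1 - Real.exp (-(t * (1 - t) / n) / 2)) :=
        mul_le_mul hc hexp (by positivity) (Real.cos_one_pos.le.trans hc)
    _ = _ := by ring

end MixingMeasure

lemma le_dW {μ ν : Measure ℝ} {B : ℝ}
    (hB : ∀ φ : ℝ → ℝ, LipschitzWith 1 φ → |∫ x, φ x ∂μ - ∫ x, φ x ∂ν| ≤ B)
    {φ : ℝ → ℝ} (hφ : LipschitzWith 1 φ) : |∫ x, φ x ∂μ - ∫ x, φ x ∂ν| ≤ dW μ ν :=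
  le_ciSup (f := fun φ : {f : ℝ → ℝ // LipschitzWith 1 f} => |∫ x, φ.1 x ∂μ - ∫ x, φ.1 x ∂ν|)
    ⟨B, by rintro _ ⟨φ, rfl⟩; exact hB φ.1 φ.2⟩ ⟨φ, hφ⟩

lemma dW_le {μ ν : Measure ℝ} {B : ℝ}
    (hB : ∀ φ : ℝ → ℝ, LipschitzWith 1 φ → |∫ x, φ x ∂μ - ∫ x, φ x ∂ν| ≤ B) : dW μ ν ≤ B :=
  haveI : Nonempty {f : ℝ → ℝ // LipschitzWith 1 f} := ⟨⟨id, LipschitzWith.id⟩⟩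
  ciSup_le fun φ => hB φ.1 φ.2

/-- If `μ({0,1}) = 0`, then `d_W(X̄ₙ, θ)` and `d_W(θ + √(θ(1-θ)/n)Z, θ)` are of the
same order. -/
theorem stmt_4 (μ : Measure ℝ) [IsProbabilityMeasure μ]
    (hsupp : μ (Set.Icc (0 : ℝ) 1)ᶜ = 0) (h01 : μ ({0, 1} : Set ℝ) = 0) :
    ∃ c C : ℝ, 0 < c ∧ c ≤ C ∧
      ∀ n : ℕ, 1 ≤ n →
        c * dW (perturbedLaw μ n) μ ≤ dW (barLaw μ n) μ ∧
        dW (barLaw μ n) μ ≤ C * dW (perturbedLaw μ n) μ := by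
  have hIcc : ∀ᵐ t ∂μ, t ∈ Icc (0 : ℝ) 1 := hsupp
  have hIoo : ∀ᵐ t ∂μ, t ∈ Ioo (0 : ℝ) 1 := by
    have hne : ∀ᵐ t ∂μ, t ∉ ({0, 1} : Set ℝ) := measure_eq_zero_iff_ae_notMem.1 h01
    filter_upwards [hIcc, hne] with t ht ht'
    simp only [mem_insert_iff, mem_singleton_iff, not_or] at ht'
    exact ⟨lt_of_le_of_ne ht.1 (Ne.symm ht'.1), lt_of_le_of_ne ht.2 ht'.2⟩
  have hv := integral_mul_one_sub_pos hIoo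
  have hcos := Real.cos_one_pos
  set v := ∫ t, t * (1 - t) ∂μ
  set α : ℝ := Real.cos 1 * v / 4
  have hα : 0 < α := by positivity
  set C : ℝ := 1 + 10 / α
  have hC : 1 ≤ C := le_add_of_nonneg_right (by positivity)
  refine ⟨C⁻¹, C, by positivity, (inv_le_one_of_one_le₀ hC).trans hC, fun n hn => ?_⟩
  have hn0 : (0 : ℝ) < n := by exact_mod_cast hn
  have hclose := fun φ (hφ : LipschitzWith 1 φ) =>
    abs_integral_barLaw_sub_integral_perturbedLaw_le hIoo hn hφ
  have hpert := fun φ (hφ : LipschitzWith 1 φ) =>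
    abs_integral_perturbedLaw_sub_integral_le hIcc n hφ
  have hbar : ∀ φ : ℝ → ℝ, LipschitzWith 1 φ →
      |∫ x, φ x ∂barLaw μ n - ∫ x, φ x ∂μ| ≤ 10 / n + 1 := fun φ hφ =>
    (abs_sub_le _ _ _).trans (add_le_add (hclose φ hφ) (hpert φ hφ))
  have hab : dW (barLaw μ n) μ ≤ 10 / n + dW (perturbedLaw μ n) μ :=
    dW_le fun φ hφ => (abs_sub_le _ _ _).trans (add_le_add (hclose φ hφ) (le_dW hpert hφ))
  have hba : dW (perturbedLaw μ n) μ ≤ 10 / n + dW (barLaw μ n) μ :=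
    dW_le fun φ hφ => (abs_sub_le _ _ _).trans
      (add_le_add ((abs_sub_comm _ _).trans_le (hclose φ hφ)) (le_dW hbar hφ))
  have ha : α / n ≤ dW (barLaw μ n) μ := by
    obtain ⟨φ, hφ, h⟩ := exists_lipschitz_barLaw_ge hIcc hn
    refine le_trans ?_ (h.trans ((le_abs_self _).trans (le_dW hbar hφ)))
    rw [← div_div]
    refine div_le_div_of_nonneg_right ?_ hn0.le
    have := mul_le_mul_of_nonneg_right (Real.cos_le_one 1) hv.le
    simp only [α]
    linarith
  have hb : α / n ≤ dW (perturbedLaw μ n) μ := by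
    obtain ⟨φ, hφ, h⟩ := exists_lipschitz_perturbedLaw_ge hIcc hn
    refine le_trans ?_ (h.trans ((neg_sub _ _).symm.trans_le
      ((neg_le_abs _).trans (le_dW hpert hφ))))
    rw [← div_div]
  have habsorb : ∀ x : ℝ, α / n ≤ x → 10 / n + x ≤ C * x := fun x hx => by
    have := mul_le_mul_of_nonneg_left hx (show 0 ≤ 10 / α by positivity)
    rw [show 10 / α * (α / n) = 10 / n by field_simp] at this
    simp only [C]
    linarith
  refine ⟨?_, hab.trans (habsorb _ hb)⟩
  rw [inv_mul_le_iff₀ (by positivity)]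
  exact hba.trans (habsorb _ ha)
end

section
/- Let γ ∈ (0,1) and let μ be the probability measure on [0,1] with density p(x) = C_p (x − 1/2)^{γ−1} 1_{(1/2, 3/4)}(x), where C_p = γ·4^γ is the normalizing constant. Let θ have law μ and let X̄_n have law P[X̄_n = k/n] = C(n,k) ∫_0^1 t^k (1-t)^{n-k} μ(dt). Then there exists a constant K > 0 such that for all n ≥ 1, d_W(X̄_n, θ) ≤ K / n^{(1+γ)/2}. -/
open MeasureTheory ProbabilityTheory Set

/-- The Bernstein operator of degree `n` applied to `f`, evaluated at `t`. -/
noncomputable def bernsteinOp (n : ℕ) (f : ℝ → ℝ) (t : ℝ) : ℝ :=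
  ∑ k ∈ Finset.range (n + 1), f ((k : ℝ) / n) * (bernsteinPolynomial ℝ n k).eval t

theorem eval_bernsteinPolynomial (n k : ℕ) (t : ℝ) :
    (bernsteinPolynomial ℝ n k).eval t = (n.choose k : ℝ) * (t ^ k * (1 - t) ^ (n - k)) := by
  simp [bernsteinPolynomial, mul_assoc]

theorem eval_bernsteinPolynomial_nonneg (n k : ℕ) {t : ℝ} (ht : t ∈ Icc (0 : ℝ) 1) :
    0 ≤ (bernsteinPolynomial ℝ n k).eval t := by
  rw [eval_bernsteinPolynomial]
  have h0 := ht.1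
  have h1 : 0 ≤ 1 - t := sub_nonneg.2 ht.2
  positivity

theorem sum_eval_bernsteinPolynomial (n : ℕ) (t : ℝ) :
    ∑ k ∈ Finset.range (n + 1), (bernsteinPolynomial ℝ n k).eval t = 1 := by
  rw [← Polynomial.eval_finsetSum, bernsteinPolynomial.sum, Polynomial.eval_one]

theorem sum_div_mul_eval_bernsteinPolynomial {n : ℕ} (hn : n ≠ 0) (t : ℝ) :
    ∑ k ∈ Finset.range (n + 1), (k : ℝ) / n * (bernsteinPolynomial ℝ n k).eval t = t := by
  have h := congrArg (Polynomial.eval t) (bernsteinPolynomial.sum_smul ℝ n)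
  simp only [Polynomial.eval_finsetSum,
    nsmul_eq_mul] at h
  have hn' : (n : ℝ) ≠ 0 := Nat.cast_ne_zero.2 hn
  simp_rw [div_mul_eq_mul_div]
  rw [← Finset.sum_div, div_eq_iff hn', mul_comm t]
  simpa using h

theorem sum_sq_mul_eval_bernsteinPolynomial {n : ℕ} (hn : n ≠ 0) (t : ℝ) :
    ∑ k ∈ Finset.range (n + 1), ((k : ℝ) / n - t) ^ 2 * (bernsteinPolynomial ℝ n k).eval t =
      t * (1 - t) / n := by
  have h := congrArg (Polynomial.eval t) (bernsteinPolynomial.variance ℝ n)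
  simp only [Polynomial.eval_finsetSum, Polynomial.eval_mul, Polynomial.eval_pow,
    Polynomial.eval_sub, Polynomial.eval_X, Polynomial.eval_one, Polynomial.eval_natCast,
    nsmul_eq_mul] at h
  have hn' : (n : ℝ) ≠ 0 := Nat.cast_ne_zero.2 hn
  have h2 : ∀ k : ℕ, ((k : ℝ) / n - t) ^ 2 * (bernsteinPolynomial ℝ n k).eval t =
      (n * t - k) ^ 2 * (bernsteinPolynomial ℝ n k).eval t / (n : ℝ) ^ 2 := by
    intro k
    field_simp
    ring
  simp_rw [h2]
  rw [← Finset.sum_div, h]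
  field_simp

theorem sum_sq_mul_eval_bernsteinPolynomial_le {n : ℕ} (hn : n ≠ 0) (t : ℝ) :
    ∑ k ∈ Finset.range (n + 1), ((k : ℝ) / n - t) ^ 2 * (bernsteinPolynomial ℝ n k).eval t ≤
      1 / n := by
  rw [sum_sq_mul_eval_bernsteinPolynomial hn]
  gcongr
  nlinarith [sq_nonneg (t - 1 / 2)]

theorem bernsteinOp_sub (n : ℕ) (f : ℝ → ℝ) (c t : ℝ) :
    bernsteinOp n f t - c =
      ∑ k ∈ Finset.range (n + 1),
        (f ((k : ℝ) / n) - c) * (bernsteinPolynomial ℝ n k).eval t := by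
  simp_rw [sub_mul]
  rw [Finset.sum_sub_distrib, ← Finset.mul_sum, sum_eval_bernsteinPolynomial, mul_one,
    bernsteinOp]

theorem continuous_bernsteinOp (n : ℕ) (f : ℝ → ℝ) : Continuous (bernsteinOp n f) := by
  unfold bernsteinOp
  fun_prop

theorem abs_bernsteinOp_sub_le_of_lipschitzWith {n : ℕ} (hn : n ≠ 0) {f : ℝ → ℝ}
    (hf : LipschitzWith 1 f) {t : ℝ} (ht : t ∈ Icc (0 : ℝ) 1) :
    |bernsteinOp n f t - f t| ≤ 1 / √n := by
  have hs : 0 < √(n : ℝ) := Real.sqrt_pos.2 (by positivity)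
  have hs2 : √(n : ℝ) ^ 2 = n := Real.sq_sqrt (by positivity)
  rw [bernsteinOp_sub]
  calc _ ≤ ∑ k ∈ Finset.range (n + 1),
        (√n / 2 * (((k : ℝ) / n - t) ^ 2 * (bernsteinPolynomial ℝ n k).eval t) +
          1 / (2 * √n) * (bernsteinPolynomial ℝ n k).eval t) := by
        refine (Finset.abs_sum_le_sum_abs _ _).trans (Finset.sum_le_sum fun k _ => ?_)
        have hb := eval_bernsteinPolynomial_nonneg n k ht
        rw [abs_mul, abs_of_nonneg hb, ← mul_assoc, ← add_mul]
        refine mul_le_mul_of_nonneg_right ?_ hb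
        have h1 : |f ((k : ℝ) / n) - f t| ≤ |(k : ℝ) / n - t| := by
          simpa [Real.dist_eq] using hf.dist_le_mul ((k : ℝ) / n) t
        refine h1.trans ?_
        rw [← sq_abs ((k : ℝ) / n - t)]
        have h3 : √(n : ℝ) / 2 * |(k : ℝ) / n - t| ^ 2 + 1 / (2 * √n) - |(k : ℝ) / n - t| =
            (√n * |(k : ℝ) / n - t| - 1) ^ 2 / (2 * √n) := by
          field_simp
          ring
        have h4 : 0 ≤ (√n * |(k : ℝ) / n - t| - 1) ^ 2 / (2 * √n) := by positivity
        linarith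
    _ ≤ √n / 2 * (1 / n) + 1 / (2 * √n) * 1 := by
        rw [Finset.sum_add_distrib, ← Finset.mul_sum, ← Finset.mul_sum,
          sum_eval_bernsteinPolynomial]
        gcongr
        exact sum_sq_mul_eval_bernsteinPolynomial_le hn t
    _ = 1 / √n := by
        rw [← hs2]
        simp only [Real.sqrt_sq hs.le]
        field_simp
        norm_num

theorem exists_mul_sub_eq_sub_of_hasDerivAt {F f : ℝ → ℝ} (hF : ∀ x, HasDerivAt F (f x) x)
    (x y : ℝ) : ∃ z ∈ uIcc x y, F y - F x = f z * (y - x) := by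
  have hc : Continuous F := continuous_iff_continuousAt.2 fun z => (hF z).continuousAt
  rcases lt_trichotomy x y with h | h | h
  · obtain ⟨z, hz, e⟩ := exists_hasDerivAt_eq_slope F f h hc.continuousOn fun z _ => hF z
    refine ⟨z, Icc_subset_uIcc (Ioo_subset_Icc_self hz), ?_⟩
    rw [e, div_mul_cancel₀ _ (sub_pos.2 h).ne']
  · exact ⟨x, left_mem_uIcc, by simp [h]⟩
  · obtain ⟨z, hz, e⟩ := exists_hasDerivAt_eq_slope F f h hc.continuousOn fun z _ => hF z
    refine ⟨z, Icc_subset_uIcc' (Ioo_subset_Icc_self hz), ?_⟩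
    have := (sub_pos.2 h).ne'
    rw [e]
    field_simp
    ring

theorem abs_bernsteinOp_sub_le_of_hasDerivAt {n : ℕ} (hn : n ≠ 0) {F f : ℝ → ℝ}
    (hf : LipschitzWith 1 f) (hF : ∀ x, HasDerivAt F (f x) x) {t : ℝ}
    (ht : t ∈ Icc (0 : ℝ) 1) :
    |bernsteinOp n F t - F t| ≤ 1 / n := by
  have key : bernsteinOp n F t - F t =
      ∑ k ∈ Finset.range (n + 1), (F ((k : ℝ) / n) - F t - f t * ((k : ℝ) / n - t)) *
        (bernsteinPolynomial ℝ n k).eval t := by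
    rw [bernsteinOp_sub]
    have h0 : ∑ k ∈ Finset.range (n + 1), f t * ((k : ℝ) / n - t) *
        (bernsteinPolynomial ℝ n k).eval t = 0 := by
      simp_rw [mul_assoc, sub_mul]
      rw [← Finset.mul_sum, Finset.sum_sub_distrib, ← Finset.mul_sum,
        sum_eval_bernsteinPolynomial, sum_div_mul_eval_bernsteinPolynomial hn]
      ring
    simp_rw [sub_mul _ (f t * _)]
    rw [Finset.sum_sub_distrib, h0, sub_zero]
  rw [key]
  refine ((Finset.abs_sum_le_sum_abs _ _).trans (Finset.sum_le_sum fun k _ => ?_)).trans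
    (sum_sq_mul_eval_bernsteinPolynomial_le hn t)
  have hb := eval_bernsteinPolynomial_nonneg n k ht
  rw [abs_mul, abs_of_nonneg hb]
  refine mul_le_mul_of_nonneg_right ?_ hb
  obtain ⟨z, hz, e⟩ := exists_mul_sub_eq_sub_of_hasDerivAt hF t ((k : ℝ) / n)
  rw [e, ← sub_mul, abs_mul, ← sq_abs, sq]
  refine mul_le_mul_of_nonneg_right ?_ (abs_nonneg _)
  have h1 : |f z - f t| ≤ |z - t| := by simpa [Real.dist_eq] using hf.dist_le_mul z t
  exact h1.trans (abs_sub_left_of_mem_uIcc hz)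

/-- The derivative of the Bernstein operator of degree `n + 1`: a sum of forward differences. -/
noncomputable def bernsteinOpDeriv (n : ℕ) (F : ℝ → ℝ) (t : ℝ) : ℝ :=
  ∑ k ∈ Finset.range (n + 1),
    ((n + 1) * (F (((k + 1 : ℕ) : ℝ) / (n + 1 : ℕ)) - F ((k : ℝ) / (n + 1 : ℕ)))) *
      (bernsteinPolynomial ℝ n k).eval t

theorem continuous_bernsteinOpDeriv (n : ℕ) (F : ℝ → ℝ) : Continuous (bernsteinOpDeriv n F) := by
  unfold bernsteinOpDeriv
  fun_prop

theorem hasDerivAt_bernsteinOp_succ (n : ℕ) (F : ℝ → ℝ) (t : ℝ) :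
    HasDerivAt (bernsteinOp (n + 1) F) (bernsteinOpDeriv n F t) t := by
  have h : HasDerivAt (bernsteinOp (n + 1) F)
      (∑ k ∈ Finset.range (n + 1 + 1), F ((k : ℝ) / (n + 1 : ℕ)) *
        (Polynomial.derivative (bernsteinPolynomial ℝ (n + 1) k)).eval t) t := by
    unfold bernsteinOp
    exact HasDerivAt.fun_sum fun k _ =>
      ((bernsteinPolynomial ℝ (n + 1) k).hasDerivAt t).const_mul _
  convert h using 1
  rw [Finset.sum_range_succ', bernsteinPolynomial.derivative_zero]
  simp_rw [bernsteinPolynomial.derivative_succ]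
  simp only [Polynomial.eval_mul, Polynomial.eval_sub, Polynomial.eval_neg,
    Polynomial.eval_natCast, Nat.add_sub_cancel, bernsteinOpDeriv]
  set b : ℕ → ℝ := fun k => (bernsteinPolynomial ℝ n k).eval t with hb
  set G : ℕ → ℝ := fun k => F ((k : ℝ) / (n + 1 : ℕ)) with hG
  have hz : b (n + 1) = 0 := by
    simp [hb, bernsteinPolynomial.eq_zero_of_lt ℝ (Nat.lt_succ_self n)]
  have hsum := Finset.sum_range_succ' (fun k => G k * b k) (n + 1)
  rw [Finset.sum_range_succ] at hsum
  simp only [hz, mul_zero, add_zero] at hsum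
  change ∑ k ∈ Finset.range (n + 1), ((n + 1 : ℝ) * (G (k + 1) - G k)) * b k =
    ∑ k ∈ Finset.range (n + 1), G (k + 1) * (((n + 1 : ℕ) : ℝ) * (b k - b (k + 1))) +
      G 0 * (-((n + 1 : ℕ) : ℝ) * b 0)
  have e1 : ∑ k ∈ Finset.range (n + 1), ((n + 1 : ℝ) * (G (k + 1) - G k)) * b k =
      (n + 1) * ∑ k ∈ Finset.range (n + 1), G (k + 1) * b k -
        (n + 1) * ∑ k ∈ Finset.range (n + 1), G k * b k := by
    rw [Finset.mul_sum, Finset.mul_sum, ← Finset.sum_sub_distrib]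
    exact Finset.sum_congr rfl fun k _ => by ring
  have e2 : ∑ k ∈ Finset.range (n + 1), G (k + 1) * (((n + 1 : ℕ) : ℝ) * (b k - b (k + 1))) =
      (n + 1) * ∑ k ∈ Finset.range (n + 1), G (k + 1) * b k -
        (n + 1) * ∑ k ∈ Finset.range (n + 1), G (k + 1) * b (k + 1) := by
    rw [Finset.mul_sum, Finset.mul_sum, ← Finset.sum_sub_distrib]
    exact Finset.sum_congr rfl fun k _ => by push_cast; ring
  rw [e1, e2, hsum]
  push_cast
  ring

theorem abs_bernsteinOp_sub_bernsteinOpDeriv_le {n : ℕ} (hn : n ≠ 0) {F f : ℝ → ℝ}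
    (hf : LipschitzWith 1 f) (hF : ∀ x, HasDerivAt F (f x) x) {t : ℝ}
    (ht : t ∈ Icc (0 : ℝ) 1) :
    |bernsteinOp n f t - bernsteinOpDeriv n F t| ≤ 1 / n := by
  have hn' : 0 < (n : ℝ) := by positivity
  rw [bernsteinOp, bernsteinOpDeriv, ← Finset.sum_sub_distrib]
  calc _ ≤ ∑ k ∈ Finset.range (n + 1), 1 / (n : ℝ) * (bernsteinPolynomial ℝ n k).eval t := by
        refine (Finset.abs_sum_le_sum_abs _ _).trans (Finset.sum_le_sum fun k hk => ?_)
        have hb := eval_bernsteinPolynomial_nonneg n k ht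
        rw [← sub_mul, abs_mul, abs_of_nonneg hb]
        refine mul_le_mul_of_nonneg_right ?_ hb
        have hk' : (k : ℝ) ≤ n := by exact_mod_cast Nat.lt_succ_iff.1 (Finset.mem_range.1 hk)
        obtain ⟨z, hz, e⟩ := exists_mul_sub_eq_sub_of_hasDerivAt hF ((k : ℝ) / (n + 1 : ℕ))
          (((k + 1 : ℕ) : ℝ) / (n + 1 : ℕ))
        have hle : (k : ℝ) / (n + 1 : ℕ) ≤ ((k + 1 : ℕ) : ℝ) / (n + 1 : ℕ) := by
          gcongr
          omega
        rw [uIcc_of_le hle] at hz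
        have e' : (n + 1 : ℝ) * (F (((k + 1 : ℕ) : ℝ) / (n + 1 : ℕ)) -
            F ((k : ℝ) / (n + 1 : ℕ))) = f z := by
          rw [e]
          push_cast
          field_simp
          ring
        rw [e']
        have h1 : |f ((k : ℝ) / n) - f z| ≤ |(k : ℝ) / n - z| := by
          simpa [Real.dist_eq] using hf.dist_le_mul ((k : ℝ) / n) z
        refine h1.trans ?_
        obtain ⟨hz1, hz2⟩ := hz
        push_cast at hz1 hz2
        have a1 : (k : ℝ) / (n + 1) ≤ k / n := by gcongr; linarith
        have a2 : (k : ℝ) / n ≤ (k + 1) / (n + 1) := by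
          rw [div_le_div_iff₀ hn' (by positivity)]
          nlinarith
        have a3 : ((k : ℝ) + 1) / (n + 1) - k / (n + 1) = 1 / (n + 1) := by ring
        have a4 : 1 / ((n : ℝ) + 1) ≤ 1 / n := by gcongr; linarith
        rw [abs_le]
        constructor <;> linarith
    _ = 1 / n := by rw [← Finset.mul_sum, sum_eval_bernsteinPolynomial, mul_one]

/-- On `[0, 1]`, the Bernstein error of a 1-Lipschitz function is, up to `1 / n`, the derivative
of a function that is itself bounded by `1 / n`. -/
theorem exists_hasDerivAt_bernsteinOp_sub {n : ℕ} (hn : n ≠ 0) {f : ℝ → ℝ}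
    (hf : LipschitzWith 1 f) :
    ∃ h h' : ℝ → ℝ, Continuous h' ∧ (∀ x, HasDerivAt h (h' x) x) ∧
      (∀ x ∈ Icc (0 : ℝ) 1, |h x| ≤ 1 / n) ∧
      ∀ x ∈ Icc (0 : ℝ) 1, |bernsteinOp n f x - f x - h' x| ≤ 1 / n := by
  set F : ℝ → ℝ := fun x => ∫ y in (0 : ℝ)..x, f y
  have hF : ∀ x, HasDerivAt F (f x) x := fun x =>
    intervalIntegral.integral_hasDerivAt_right (hf.continuous.intervalIntegrable _ _)
      hf.continuous.stronglyMeasurable.stronglyMeasurableAtFilter hf.continuous.continuousAt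
  refine ⟨fun x => bernsteinOp (n + 1) F x - F x, fun x => bernsteinOpDeriv n F x - f x,
    (continuous_bernsteinOpDeriv n F).sub hf.continuous,
    fun x => (hasDerivAt_bernsteinOp_succ n F x).sub (hF x), fun x hx => ?_, fun x hx => ?_⟩
  · refine (abs_bernsteinOp_sub_le_of_hasDerivAt n.succ_ne_zero hf hF hx).trans ?_
    have : 0 < (n : ℝ) := by positivity
    gcongr
    omega
  · rw [sub_sub_sub_cancel_right]
    exact abs_bernsteinOp_sub_bernsteinOpDeriv_le hn hf hF hx

theorem integral_barLaw_eq_integral_bernsteinOp (μ : Measure ℝ) [IsFiniteMeasure μ]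
    (hμ : ∀ᵐ t ∂μ, t ∈ Icc (0 : ℝ) 1) (n : ℕ) (f : ℝ → ℝ) :
    ∫ x, f x ∂(barLaw μ n) = ∫ x, bernsteinOp n f x ∂μ := by
  have hint : ∀ k, Integrable (fun t => (bernsteinPolynomial ℝ n k).eval t) μ := by
    intro k
    refine Integrable.of_bound (C := (n.choose k : ℝ))
      (by fun_prop : Continuous fun t => (bernsteinPolynomial ℝ n k).eval t).aestronglyMeasurable
      ?_
    filter_upwards [hμ] with t ht
    have h0 : 0 ≤ 1 - t := sub_nonneg.2 ht.2
    rw [Real.norm_of_nonneg (eval_bernsteinPolynomial_nonneg n k ht),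
      eval_bernsteinPolynomial]
    exact mul_le_of_le_one_right (by positivity)
      (mul_le_one₀ (pow_le_one₀ ht.1 ht.2) (by positivity)
        (pow_le_one₀ h0 (by linarith [ht.1])))
  have hw : ∀ k, (n.choose k : ℝ) * ∫ t, t ^ k * (1 - t) ^ (n - k) ∂μ =
      ∫ t, (bernsteinPolynomial ℝ n k).eval t ∂μ := by
    intro k
    rw [← integral_const_mul]
    simp_rw [eval_bernsteinPolynomial]
  have hw0 : ∀ k, 0 ≤ ∫ t, (bernsteinPolynomial ℝ n k).eval t ∂μ := fun k =>
    integral_nonneg_of_ae (by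
      filter_upwards [hμ] with t ht using eval_bernsteinPolynomial_nonneg n k ht)
  unfold barLaw bernsteinOp
  rw [integral_finsetSum_measure, integral_finsetSum _ fun k _ => (hint k).const_mul _]
  · refine Finset.sum_congr rfl fun k _ => ?_
    rw [integral_smul_measure, integral_dirac, integral_const_mul, hw,
      ENNReal.toReal_ofReal (hw0 k), smul_eq_mul, mul_comm]
  · intro k _
    exact (integrable_dirac (by simp)).smul_measure ENNReal.ofReal_ne_top

theorem abs_integral_mul_deriv_le {a b ε : ℝ} (hab : a ≤ b) {h h' p p' : ℝ → ℝ}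
    (hh : ∀ x, HasDerivAt h (h' x) x) (hh' : Continuous h')
    (hp : ∀ x ∈ Icc a b, HasDerivAt p (p' x) x) (hp' : ContinuousOn p' (Icc a b))
    (hε : ∀ x ∈ Icc a b, |h x| ≤ ε) (hp0 : ∀ x ∈ Icc a b, 0 ≤ p x)
    (hp'0 : ∀ x ∈ Icc a b, p' x ≤ 0) :
    |∫ x in a..b, p x * h' x| ≤ 2 * ε * p a := by
  have hu := uIcc_of_le hab
  have hp'i : IntervalIntegrable p' volume a b := ContinuousOn.intervalIntegrable (by rwa [hu])
  rw [intervalIntegral.integral_mul_deriv_eq_deriv_mul (by rwa [hu]) (fun x _ => hh x) hp'i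
    (hh'.intervalIntegrable _ _)]
  have h1 : |∫ x in a..b, p' x * h x| ≤ ∫ x in a..b, -ε * p' x := by
    rw [← Real.norm_eq_abs]
    refine intervalIntegral.norm_integral_le_of_norm_le hab (ae_of_all _ fun x hx => ?_)
      (hp'i.const_mul _)
    have hx' := Ioc_subset_Icc_self hx
    rw [Real.norm_eq_abs, abs_mul, abs_of_nonpos (hp'0 x hx')]
    nlinarith [hε x hx', hp'0 x hx']
  rw [intervalIntegral.integral_const_mul,
    intervalIntegral.integral_eq_sub_of_hasDerivAt (by rwa [hu]) hp'i] at h1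
  have ha := left_mem_Icc.2 hab
  have hb := right_mem_Icc.2 hab
  have h2 : |p b * h b| ≤ p b * ε := by
    rw [abs_mul, abs_of_nonneg (hp0 b hb)]
    exact mul_le_mul_of_nonneg_left (hε b hb) (hp0 b hb)
  have h3 : |p a * h a| ≤ p a * ε := by
    rw [abs_mul, abs_of_nonneg (hp0 a ha)]
    exact mul_le_mul_of_nonneg_left (hε a ha) (hp0 a ha)
  rw [abs_le] at *
  constructor <;> linarith

theorem intervalIntegrable_mul_sub_rpow {γ : ℝ} (hγ : 0 < γ) (C x₀ a b : ℝ) :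
    IntervalIntegrable (fun x => C * (x - x₀) ^ (γ - 1)) volume a b := by
  have h := (intervalIntegral.intervalIntegrable_rpow' (a := a - x₀) (b := b - x₀)
    (r := γ - 1) (by linarith)).comp_sub_right x₀
  simp only [sub_add_cancel] at h
  exact h.const_mul C

theorem integral_mul_sub_rpow {γ : ℝ} (hγ : 0 < γ) (C x₀ a b : ℝ) :
    ∫ x in a..b, γ * C * (x - x₀) ^ (γ - 1) = C * ((b - x₀) ^ γ - (a - x₀) ^ γ) := by
  rw [intervalIntegral.integral_const_mul,
    intervalIntegral.integral_comp_sub_right (fun x => x ^ (γ - 1)),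
    integral_rpow (Or.inl (by linarith)), sub_add_cancel]
  field_simp

/-- Cut the integral at distance `1 / (4 √n)` from the singularity: near it use the pointwise
bound on the Bernstein error, away from it integrate by parts. -/
theorem abs_integral_density_mul_bernsteinOp_sub_le {γ : ℝ} (hγ : γ ∈ Ioo (0 : ℝ) 1) {n : ℕ}
    (hn : n ≠ 0) {f : ℝ → ℝ} (hf : LipschitzWith 1 f) :
    |∫ x in (1 / 2 : ℝ)..(3 / 4),
        γ * (4 : ℝ) ^ γ * (x - 1 / 2) ^ (γ - 1) * (bernsteinOp n f x - f x)| ≤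
      10 / (n : ℝ) ^ ((1 + γ) / 2) := by
  obtain ⟨h0, h1⟩ := hγ
  set p : ℝ → ℝ := fun x => γ * (4 : ℝ) ^ γ * (x - 1 / 2) ^ (γ - 1) with hpdef
  set s : ℝ := √n with hs
  have hn1 : (1 : ℝ) ≤ n := by exact_mod_cast Nat.one_le_iff_ne_zero.2 hn
  have hs1 : 1 ≤ s := Real.one_le_sqrt.2 hn1
  have hs0 : 0 < s := by linarith
  have hsn : (n : ℝ) = s ^ 2 := (Real.sq_sqrt (by positivity)).symm
  have hδ0 : 0 < 1 / (4 * s) := by positivity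
  have hδ1 : 1 / (4 * s) ≤ 1 / 4 := by
    gcongr
    linarith
  set c : ℝ := 1 / 2 + 1 / (4 * s) with hc
  have hc0 : 1 / 2 ≤ c := by linarith
  have hc1 : c ≤ 3 / 4 := by linarith
  have hcs : c - 1 / 2 = 1 / (4 * s) := by rw [hc]; ring
  have hpi : ∀ a b, IntervalIntegrable p volume a b :=
    fun a b => intervalIntegrable_mul_sub_rpow h0 _ _ a b
  have hpint : ∀ a b, ∫ x in a..b, p x = 4 ^ γ * ((b - 1 / 2) ^ γ - (a - 1 / 2) ^ γ) :=
    fun a b => integral_mul_sub_rpow h0 _ _ a b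
  have hp0 : ∀ x, 1 / 2 ≤ x → 0 ≤ p x := fun x hx => by
    have : 0 ≤ x - 1 / 2 := by linarith
    simp only [hpdef]
    positivity
  have hdiff : Continuous fun x => bernsteinOp n f x - f x :=
    (continuous_bernsteinOp n f).sub hf.continuous
  have hmul : ∀ {g : ℝ → ℝ}, Continuous g → ∀ a b,
      IntervalIntegrable (fun x => p x * g x) volume a b :=
    fun hg a b => (hpi a b).mul_continuousOn hg.continuousOn
  have hbound : ∀ {g : ℝ → ℝ} {a b ε : ℝ}, 1 / 2 ≤ a → a ≤ b → b ≤ 3 / 4 →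
      (∀ x ∈ Icc (0 : ℝ) 1, |g x| ≤ ε) →
      |∫ x in a..b, p x * g x| ≤ ε * ∫ x in a..b, p x := by
    intro g a b ε ha hab hb hg
    rw [← intervalIntegral.integral_const_mul, ← Real.norm_eq_abs]
    refine intervalIntegral.norm_integral_le_of_norm_le hab (ae_of_all _ fun x hx => ?_)
      ((hpi a b).const_mul ε)
    have hx1 := hp0 x (ha.trans hx.1.le)
    rw [Real.norm_eq_abs, abs_mul, abs_of_nonneg hx1, mul_comm]
    exact mul_le_mul_of_nonneg_right
      (hg x ⟨by linarith [hx.1], by linarith [hx.2]⟩) hx1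
  have near : |∫ x in (1 / 2)..c, p x * (bernsteinOp n f x - f x)| ≤ 1 / s ^ (1 + γ) := by
    refine (hbound le_rfl hc0 hc1 fun x hx =>
      abs_bernsteinOp_sub_le_of_lipschitzWith hn hf hx).trans_eq ?_
    rw [hpint, hcs, sub_self, Real.zero_rpow h0.ne', sub_zero,
      Real.div_rpow zero_le_one (by positivity), Real.one_rpow,
      Real.mul_rpow (by norm_num) hs0.le, Real.rpow_add hs0, Real.rpow_one, ← hs]
    field_simp
  obtain ⟨h, h', hh'c, hh, hhε, hrem⟩ := exists_hasDerivAt_bernsteinOp_sub hn hf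
  have hpow : s ^ (1 + γ) ≤ s ^ 2 := by
    rw [← Real.rpow_natCast]
    exact Real.rpow_le_rpow_of_exponent_le hs1 (by push_cast; linarith)
  have hpos : 0 < s ^ (1 + γ) := by positivity
  have far₁ : |∫ x in c..(3 / 4), p x * (bernsteinOp n f x - f x - h' x)| ≤
      1 / s ^ (1 + γ) := by
    refine (hbound hc0 hc1 le_rfl hrem).trans ?_
    have hle : ∫ x in c..(3 / 4), p x ≤ 1 := by
      rw [hpint, mul_sub, ← Real.mul_rpow (by norm_num) (by norm_num)]
      have : 0 ≤ (4 : ℝ) ^ γ * (c - 1 / 2) ^ γ := by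
        rw [hcs]
        positivity
      norm_num at this ⊢
      exact this
    calc _ ≤ 1 / (n : ℝ) * 1 := by gcongr
      _ ≤ 1 / s ^ (1 + γ) := by
        rw [mul_one, hsn]
        gcongr
  have far₂ : |∫ x in c..(3 / 4), p x * h' x| ≤ 8 / s ^ (1 + γ) := by
    have hx0 : ∀ x ∈ Icc c (3 / 4), 0 < x - 1 / 2 := fun x hx => by linarith [hx.1]
    refine (abs_integral_mul_deriv_le hc1 (p := p)
      (p' := fun x => γ * (4 : ℝ) ^ γ * ((γ - 1) * (x - 1 / 2) ^ (γ - 1 - 1))) hh hh'c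
      (fun x hx => ?_) (fun x hx => ?_)
      (fun x hx => hhε x ⟨by linarith [hx.1], by linarith [hx.2]⟩)
      (fun x hx => hp0 x (hc0.trans hx.1)) fun x hx => ?_).trans ?_
    · have := ((hasDerivAt_id x).sub_const (1 / 2)).rpow_const (p := γ - 1)
        (Or.inl (hx0 x hx).ne')
      simpa [hpdef] using this.const_mul (γ * (4 : ℝ) ^ γ)
    · exact ContinuousAt.continuousWithinAt (continuousAt_const.mul (continuousAt_const.mul
        ((continuousAt_id.sub continuousAt_const).rpow_const (Or.inl (hx0 x hx).ne'))))
    · have := hx0 x hx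
      exact mul_nonpos_of_nonneg_of_nonpos (by positivity)
        (mul_nonpos_of_nonpos_of_nonneg (by linarith) (by positivity))
    · have e : p c = 4 * γ * s ^ (1 - γ) := by
        simp only [hpdef]
        rw [hcs, one_div, Real.inv_rpow (by positivity), ← Real.rpow_neg (by positivity),
          neg_sub, Real.mul_rpow (by norm_num) hs0.le]
        have : (4 : ℝ) ^ γ * 4 ^ (1 - γ) = 4 := by
          rw [← Real.rpow_add (by norm_num)]
          norm_num
        linear_combination γ * s ^ (1 - γ) * this
      have e2 : s ^ (1 - γ) * s ^ (1 + γ) = s ^ 2 := by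
        rw [← Real.rpow_add hs0, ← Real.rpow_natCast]
        norm_num
      rw [e, hsn, le_div_iff₀ hpos]
      calc 2 * (1 / s ^ 2) * (4 * γ * s ^ (1 - γ)) * s ^ (1 + γ)
          = 8 * γ * ((s ^ (1 - γ) * s ^ (1 + γ)) / s ^ 2) := by ring
        _ = 8 * γ := by rw [e2, div_self (by positivity), mul_one]
        _ ≤ 8 := by linarith
  have hrest : Continuous fun x => bernsteinOp n f x - f x - h' x := hdiff.sub hh'c
  have hsplit : ∫ x in (1 / 2)..(3 / 4), p x * (bernsteinOp n f x - f x) =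
      (∫ x in (1 / 2)..c, p x * (bernsteinOp n f x - f x)) +
        ((∫ x in c..(3 / 4), p x * (bernsteinOp n f x - f x - h' x)) +
          ∫ x in c..(3 / 4), p x * h' x) := by
    rw [← intervalIntegral.integral_add (hmul hrest _ _) (hmul hh'c _ _),
      ← intervalIntegral.integral_add_adjacent_intervals (hmul hdiff (1 / 2) c)
        (hmul hdiff c (3 / 4))]
    simp_rw [← mul_add, sub_add_cancel]
  have hden : (n : ℝ) ^ ((1 + γ) / 2) = s ^ (1 + γ) := by
    rw [hsn, ← Real.rpow_natCast, ← Real.rpow_mul hs0.le]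
    congr 1
    push_cast
    ring
  change |∫ x in (1 / 2)..(3 / 4), p x * (bernsteinOp n f x - f x)| ≤ _
  rw [hsplit, hden]
  calc _ ≤ 1 / s ^ (1 + γ) + (1 / s ^ (1 + γ) + 8 / s ^ (1 + γ)) :=
        (abs_add_le _ _).trans (add_le_add near ((abs_add_le _ _).trans (add_le_add far₁ far₂)))
    _ = 10 / s ^ (1 + γ) := by ring

/-- For `μ` with density `p(x) = γ 4^γ (x-1/2)^(γ-1)` on `(1/2, 3/4)`,
`d_W(X̄ₙ, θ) = O(n^{-(1+γ)/2})`. -/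
theorem stmt_8 (γ : ℝ) (hγ : γ ∈ Set.Ioo (0 : ℝ) 1) (μ : Measure ℝ)
    (hμ : μ = (volume.restrict (Set.Ioo (1 / 2 : ℝ) (3 / 4))).withDensity
      fun x => ENNReal.ofReal (γ * (4 : ℝ) ^ γ * (x - 1 / 2) ^ (γ - 1))) :
    ∃ K : ℝ, 0 < K ∧ ∀ n : ℕ, 1 ≤ n →
      dW (barLaw μ n) μ ≤ K / (n : ℝ) ^ ((1 + γ) / 2) := by
  have h0 := hγ.1
  set p : ℝ → ℝ := fun x => γ * (4 : ℝ) ^ γ * (x - 1 / 2) ^ (γ - 1) with hpdef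
  have hpi : IntervalIntegrable p volume (1 / 2) (3 / 4) :=
    intervalIntegrable_mul_sub_rpow h0 _ _ _ _
  have hpm : Measurable p := by
    simp only [hpdef]
    fun_prop
  have hfin : IsFiniteMeasure μ := by
    rw [hμ]
    refine isFiniteMeasure_withDensity_ofReal ?_
    exact ((intervalIntegrable_iff_integrableOn_Ioo_of_le (by norm_num)).1 hpi).2
  have hsupp : ∀ᵐ t ∂μ, t ∈ Icc (0 : ℝ) 1 := by
    rw [hμ]
    refine (withDensity_absolutelyContinuous _ _).ae_le ?_
    filter_upwards [ae_restrict_mem measurableSet_Ioo] with t ht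
    exact ⟨by linarith [ht.1], by linarith [ht.2]⟩
  have hint : ∀ g : ℝ → ℝ, ∫ x, g x ∂μ = ∫ x in (1 / 2 : ℝ)..(3 / 4), p x * g x := by
    intro g
    rw [hμ, integral_withDensity_eq_integral_toReal_smul hpm.ennreal_ofReal
      (ae_of_all _ fun _ => ENNReal.ofReal_lt_top),
      intervalIntegral.integral_of_le (by norm_num), integral_Ioc_eq_integral_Ioo]
    refine setIntegral_congr_fun measurableSet_Ioo fun x hx => ?_
    have : 0 ≤ x - 1 / 2 := by linarith [hx.1]
    have hp0 : 0 ≤ p x := by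
      simp only [hpdef]
      positivity
    simp only [smul_eq_mul]
    rw [ENNReal.toReal_ofReal hp0]
  refine ⟨10, by norm_num, fun n hn => ?_⟩
  have : Nonempty {f : ℝ → ℝ // LipschitzWith 1 f} := ⟨⟨id, LipschitzWith.id⟩⟩
  refine ciSup_le fun φ => ?_
  obtain ⟨f, hf⟩ := φ
  have hsub : (∫ x, f x ∂(barLaw μ n)) - ∫ x, f x ∂μ =
      ∫ x in (1 / 2 : ℝ)..(3 / 4), p x * (bernsteinOp n f x - f x) := by
    rw [integral_barLaw_eq_integral_bernsteinOp μ hsupp, hint, hint,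
      ← intervalIntegral.integral_sub
        (hpi.mul_continuousOn (continuous_bernsteinOp n f).continuousOn)
        (hpi.mul_continuousOn hf.continuous.continuousOn)]
    simp_rw [mul_sub]
  change |(∫ x, f x ∂(barLaw μ n)) - ∫ x, f x ∂μ| ≤ _
  rw [hsub]
  exact abs_integral_density_mul_bernsteinOp_sub_le hγ (by omega) hf
end
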